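/- arXiv:math/0507467 — 2 statements merged into one kernel-verified Lean document; each statement's English description precedes it below -/
import Mathlib

section
/- Let V ⊂ ℂ be a nonempty open connected set and let E ⊂ V be a polar set that is relatively closed in V. Then V \ E is nonempty, open and connected. -/
open MeasureTheory Filter Metric Set

/-- `elog x` is `log x` with value `-∞` for `x ≤ 0`, as an extended real. -/
noncomputable def elog (x : ℝ) : EReal := if x ≤ 0 then ⊥ else ((Real.log x : ℝ) : EReal)

/-- The sub-mean value inequality over circles of closed discs contained in `Ω`, phrased via
continuous real-valued majorants of the (extended-real-valued) function on the circle. -/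
def SubmeanOn (u : ℂ → EReal) (Ω : Set ℂ) : Prop :=
  ∀ c : ℂ, ∀ r : ℝ, 0 < r → Metric.closedBall c r ⊆ Ω →
    ∀ φ : ℝ → ℝ, Continuous φ →
      (∀ θ : ℝ, u (c + r * Complex.exp (θ * Complex.I)) ≤ ((φ θ : ℝ) : EReal)) →
      u c ≤ (((2 * Real.pi)⁻¹ * ∫ θ in (0:ℝ)..(2 * Real.pi), φ θ : ℝ) : EReal)

/-- `u : Ω → [-∞, ∞)` is subharmonic on the open set `Ω ⊆ ℂ`: upper semicontinuous,
nowhere `+∞`, not identically `-∞` on any connected component, sub-mean value inequality. -/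
def SubharmonicOn (u : ℂ → EReal) (Ω : Set ℂ) : Prop :=
  IsOpen Ω ∧ UpperSemicontinuousOn u Ω ∧
  (∀ z ∈ Ω, u z ≠ ⊤) ∧
  (∀ z ∈ Ω, ∃ w ∈ connectedComponentIn Ω z, u w ≠ ⊥) ∧
  SubmeanOn u Ω

/-- A set `E ⊆ ℂ` is polar if some subharmonic function on an open set containing `E`
equals `-∞` on `E`. -/
def PolarSet (E : Set ℂ) : Prop :=
  ∃ Ω : Set ℂ, E ⊆ Ω ∧ ∃ u : ℂ → EReal, SubharmonicOn u Ω ∧ ∀ z ∈ E, u z = ⊥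

/-- The space of square-integrable holomorphic functions on `D`. -/
def L2h {E : Type*} [NormedAddCommGroup E] [NormedSpace ℂ E] [MeasureSpace E]
    (D : Set E) : Set (E → ℂ) :=
  {f | DifferentiableOn ℂ f D ∧ IntegrableOn (fun z => ‖f z‖ ^ 2) D volume}

/-- `D` is an `L²ₕ`-domain of holomorphy. -/
def IsL2hDomainOfHolomorphy {E : Type*} [NormedAddCommGroup E] [NormedSpace ℂ E]
    [MeasureSpace E] (D : Set E) : Prop :=
  ¬ ∃ D₀ D₁ : Set E, IsOpen D₀ ∧ IsConnected D₀ ∧ IsOpen D₁ ∧ IsConnected D₁ ∧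
      D₀ ⊆ D₁ ∩ D ∧ ¬ (D₁ ⊆ D) ∧
      ∀ f ∈ L2h D, ∃ g : E → ℂ, DifferentiableOn ℂ g D₁ ∧ Set.EqOn g f D₀

/-- The Hartogs domain `G_{D,ρ} = {(z₁,z₂) : z₁ ∈ D, |z₂| < e^{-ρ(z₁)}}`. -/
def hartogs (D : Set ℂ) (ρ : ℂ → EReal) : Set (ℂ × ℂ) :=
  {p | p.1 ∈ D ∧ elog ‖p.2‖ < - ρ p.1}

/-- `S(D)`: boundary points near which the complement of `D` is polar. -/
def polarS (D : Set ℂ) : Set ℂ :=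
  {z ∈ frontier D | ∃ U : Set ℂ, IsOpen U ∧ z ∈ U ∧ PolarSet (U \ D)}

/-- `fj` is the family of coefficients of a Hartogs expansion of `f` on `G_{D,ρ}`. -/
def HartogsExpansion (D : Set ℂ) (ρ : ℂ → EReal) (f : ℂ × ℂ → ℂ) (fj : ℕ → ℂ → ℂ) : Prop :=
  (∀ j, DifferentiableOn ℂ (fj j) D) ∧
  ∀ p ∈ hartogs D ρ, HasSum (fun j => fj j p.1 * p.2 ^ j) (f p)

/-- `ρ_f(z) = limsup_j (1/j) log |f_j(z)|` for coefficients `fj`. -/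
noncomputable def coeffGrowth (fj : ℕ → ℂ → ℂ) (z : ℂ) : EReal :=
  Filter.limsup (fun (j : ℕ) => ((((j : ℝ)⁻¹ : ℝ)) : EReal) * elog ‖fj j z‖) Filter.atTop

/-- The upper semicontinuous regularization `g*`. -/
noncomputable def uscReg (g : ℂ → EReal) (z : ℂ) : EReal := Filter.limsup g (nhds z)

/-- `ρ̃ = sup_{f ∈ L²ₕ(G_{D,ρ})} (ρ_f)*`. -/
noncomputable def rhoTilde (D : Set ℂ) (ρ : ℂ → EReal) (z : ℂ) : EReal :=
  ⨆ fj ∈ {fj : ℕ → ℂ → ℂ | ∃ f ∈ L2h (hartogs D ρ), HartogsExpansion D ρ f fj},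
    uscReg (coeffGrowth fj) z

/-- `D̂ = D ∪ {z ∈ S(D) : limsup_{D ∋ w → z} ρ(w) < ∞}`. -/
def DHat (D : Set ℂ) (ρ : ℂ → EReal) : Set ℂ :=
  D ∪ {z ∈ polarS D | Filter.limsup ρ (nhdsWithin z D) < ⊤}

open Classical in
/-- `ρ̂`, extending `ρ` to `D̂` by boundary limsups. -/
noncomputable def rhoHat (D : Set ℂ) (ρ : ℂ → EReal) (z : ℂ) : EReal :=
  if z ∈ D then ρ z else Filter.limsup ρ (nhdsWithin z D)

/-- `u` is plurisubharmonic on an open `Ω ⊆ ℂⁿ`. -/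
def PlurisubharmonicOn {n : ℕ} (u : (Fin n → ℂ) → EReal) (Ω : Set (Fin n → ℂ)) : Prop :=
  IsOpen Ω ∧ UpperSemicontinuousOn u Ω ∧
  (∀ z ∈ Ω, u z ≠ ⊤) ∧
  (∀ z ∈ Ω, ∃ w ∈ connectedComponentIn Ω z, u w ≠ ⊥) ∧
  ∀ a b : Fin n → ℂ, SubmeanOn (fun lam => u (a + lam • b)) {lam : ℂ | a + lam • b ∈ Ω}

/-- A set `E ⊆ ℂⁿ` is pluripolar. -/
def PluripolarSet {n : ℕ} (E : Set (Fin n → ℂ)) : Prop :=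
  ∃ Ω : Set (Fin n → ℂ), E ⊆ Ω ∧
    ∃ u : (Fin n → ℂ) → EReal, PlurisubharmonicOn u Ω ∧ ∀ z ∈ E, u z = ⊥

/-- `D ⊆ ℂⁿ` is pseudoconvex: it admits a plurisubharmonic exhaustion function. -/
def IsPseudoconvex {n : ℕ} (D : Set (Fin n → ℂ)) : Prop :=
  ∃ u : (Fin n → ℂ) → EReal, PlurisubharmonicOn u D ∧
    ∀ c : ℝ, IsCompact {z | z ∈ D ∧ u z ≤ (c : EReal)}

/-- `L²ₕ(D)` is infinite dimensional: arbitrarily many elements that are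
linearly independent as functions on `D`. -/
def L2hInfiniteDim {E : Type*} [NormedAddCommGroup E] [NormedSpace ℂ E] [MeasureSpace E]
    (D : Set E) : Prop :=
  ∀ N : ℕ, ∃ fs : Fin N → E → ℂ, (∀ i, fs i ∈ L2h D) ∧
    ∀ c : Fin N → ℂ, (∀ z ∈ D, ∑ i, c i * fs i z = 0) → c = 0

/-- The sub-mean value inequality for `u` over the circle of centre `c` and radius `r`, tested
against continuous real-valued majorants. -/
def SubmeanOnCircle (u : ℂ → EReal) (c : ℂ) (r : ℝ) : Prop :=
  ∀ φ : ℝ → ℝ, Continuous φ →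
    (∀ θ : ℝ, u (c + r * Complex.exp (θ * Complex.I)) ≤ ((φ θ : ℝ) : EReal)) →
    u c ≤ (((2 * Real.pi)⁻¹ * ∫ θ in (0:ℝ)..(2 * Real.pi), φ θ : ℝ) : EReal)

theorem norm_sq_circle_sub (b c : ℂ) (r θ : ℝ) :
    ‖c + r * Complex.exp (θ * Complex.I) - b‖ ^ 2 =
      (‖c - b‖ ^ 2 + r ^ 2) +
        (2 * r * (c - b).re * Real.cos θ + 2 * r * (c - b).im * Real.sin θ) := by
  rw [Complex.sq_norm, Complex.sq_norm, Complex.normSq_apply, Complex.normSq_apply,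
    Complex.exp_mul_I, ← Complex.ofReal_cos, ← Complex.ofReal_sin]
  simp only [Complex.add_re, Complex.sub_re, Complex.mul_re, Complex.ofReal_re, Complex.ofReal_im,
    Complex.I_re, Complex.I_im, Complex.add_im, Complex.sub_im, Complex.mul_im]
  linear_combination (r ^ 2) * Real.sin_sq_add_cos_sq θ

theorem integral_norm_sq_circle_sub (b c : ℂ) (r : ℝ) :
    ∫ θ in (0:ℝ)..(2 * Real.pi), ‖c + r * Complex.exp (θ * Complex.I) - b‖ ^ 2 =
      2 * Real.pi * (‖c - b‖ ^ 2 + r ^ 2) := by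
  simp_rw [norm_sq_circle_sub]
  rw [intervalIntegral.integral_add, intervalIntegral.integral_add]
  · simp [mul_add]
  all_goals exact Continuous.intervalIntegrable (by fun_prop) _ _

theorem integral_log_norm_circle_sub {b c : ℂ} {r : ℝ} (hr : 0 < r) (hb : b ∉ closedBall c r) :
    ∫ θ in (0:ℝ)..(2 * Real.pi), Real.log ‖c + r * Complex.exp (θ * Complex.I) - b‖ =
      2 * Real.pi * Real.log ‖c - b‖ := by
  have harm : InnerProductSpace.HarmonicOnNhd (fun z : ℂ => Real.log ‖z - b‖)
      (closedBall c |r|) := by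
    intro z hz
    rw [abs_of_pos hr] at hz
    refine AnalyticAt.harmonicAt_log_norm (f := fun z => z - b) (by fun_prop) ?_
    exact sub_ne_zero.2 fun h => hb (h ▸ hz)
  have h := harm.circleAverage_eq
  rw [Real.circleAverage_def, smul_eq_mul, inv_mul_eq_iff_eq_mul₀ (by positivity)] at h
  exact h

/-- A strictly superharmonic barrier: the circle means of `log ‖z - b‖ - ε ‖z - b‖ ^ 2`. -/
theorem mean_log_barrier {b c : ℂ} {r : ℝ} (hr : 0 < r) (hb : b ∉ closedBall c r)
    (A k ε : ℝ) :
    (2 * Real.pi)⁻¹ * ∫ θ in (0:ℝ)..(2 * Real.pi),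
      (A + k * (Real.log ‖c + r * Complex.exp (θ * Complex.I) - b‖ -
        ε * ‖c + r * Complex.exp (θ * Complex.I) - b‖ ^ 2)) =
      A + k * (Real.log ‖c - b‖ - ε * ‖c - b‖ ^ 2) - k * ε * r ^ 2 := by
  have hne : ∀ θ : ℝ, ‖c + r * Complex.exp (θ * Complex.I) - b‖ ≠ 0 := fun θ h => hb <| by
    rw [norm_eq_zero, sub_eq_zero] at h
    simp [← h, abs_of_pos hr, Complex.norm_exp_ofReal_mul_I]
  have hlog : Continuous fun θ : ℝ =>
      Real.log ‖c + r * Complex.exp (θ * Complex.I) - b‖ :=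
    Continuous.log (by fun_prop) hne
  rw [intervalIntegral.integral_add, intervalIntegral.integral_const_mul,
    intervalIntegral.integral_sub, intervalIntegral.integral_const_mul,
    integral_log_norm_circle_sub hr hb, integral_norm_sq_circle_sub]
  · rw [intervalIntegral.integral_const, smul_eq_mul]
    field_simp
    ring
  all_goals exact Continuous.intervalIntegrable (by fun_prop) _ _

theorem UpperSemicontinuousOn.exists_real_bound {X : Type*} [TopologicalSpace X] {v : X → EReal}
    {K : Set X} (hK : IsCompact K) (hv : UpperSemicontinuousOn v K) (htop : ∀ z ∈ K, v z ≠ ⊤) :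
    ∃ M : ℝ, ∀ z ∈ K, v z ≤ M := by
  rcases K.eq_empty_or_nonempty with rfl | hne
  · simp
  obtain ⟨a, ha, hmax⟩ := hv.exists_isMaxOn hne hK
  refine ⟨(v a).toReal, fun z hz => (hmax hz).trans (EReal.le_coe_toReal (htop a ha))⟩

/-- The value `-∞` on a small disc propagates to larger concentric discs. -/
theorem eq_bot_on_ball_of_eq_bot_on_closedBall {v : ℂ → EReal} {b : ℂ} {s R : ℝ} (hs : 0 < s)
    (husc : UpperSemicontinuousOn v (closedBall b R)) (htop : ∀ z ∈ closedBall b R, v z ≠ ⊤)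
    (hsub : ∀ c ∈ ball b R, v c ≠ ⊥ → ∀ᶠ r in nhdsWithin 0 (Ioi 0), SubmeanOnCircle v c r)
    (hbot : ∀ z ∈ closedBall b s, v z = ⊥) :
    ∀ z ∈ ball b R, v z = ⊥ := by
  intro z₀ hz₀
  by_contra hne
  obtain ⟨M, hM⟩ := husc.exists_real_bound (isCompact_closedBall b R) htop
  have hz₀R : ‖z₀ - b‖ < R := by simpa [dist_eq_norm] using hz₀
  have hz₀s : s < ‖z₀ - b‖ := by
    by_contra! h
    exact hne (hbot z₀ (by simpa [dist_eq_norm] using h))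
  have hRpos : 0 < R := by linarith
  obtain ⟨ε, hε, hεlt⟩ : ∃ ε : ℝ, 0 < ε ∧
      Real.log ‖z₀ - b‖ - ε * ‖z₀ - b‖ ^ 2 < Real.log R - ε * R ^ 2 := by
    have hlog : Real.log ‖z₀ - b‖ < Real.log R := Real.log_lt_log (by linarith) hz₀R
    have hsq : 0 < R ^ 2 := by positivity
    refine ⟨(Real.log R - Real.log ‖z₀ - b‖) / (2 * R ^ 2), div_pos (by linarith) (by positivity),
      ?_⟩
    have h1 : (Real.log R - Real.log ‖z₀ - b‖) / (2 * R ^ 2) * R ^ 2 =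
      (Real.log R - Real.log ‖z₀ - b‖) / 2 := by field_simp
    have h2 : 0 ≤ (Real.log R - Real.log ‖z₀ - b‖) / (2 * R ^ 2) * ‖z₀ - b‖ ^ 2 :=
      mul_nonneg (div_nonneg (by linarith) (by positivity)) (by positivity)
    linarith
  set g : ℂ → ℝ := fun z => Real.log ‖z - b‖ - ε * ‖z - b‖ ^ 2 with hg
  set gR : ℝ := Real.log R - ε * R ^ 2 with hgR
  have hz₀top : v z₀ ≠ ⊤ := htop z₀ (ball_subset_closedBall hz₀)
  obtain ⟨k, hk, hklt⟩ : ∃ k : ℝ, 0 < k ∧ M + k * (g z₀ - gR) < (v z₀).toReal := by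
    have hd : 0 < gR - g z₀ := sub_pos.2 hεlt
    obtain ⟨k, hk⟩ := exists_gt (max 0 ((M - (v z₀).toReal) / (gR - g z₀)))
    rw [max_lt_iff, div_lt_iff₀ hd] at hk
    exact ⟨k, hk.1, by linarith⟩
  set h : ℂ → ℝ := fun z => M + k * (g z - gR) with hh
  set K : Set ℂ := closedBall b R \ ball b s
  have hKR : K ⊆ closedBall b R := sdiff_subset
  have hK : IsCompact K := (isCompact_closedBall b R).diff isOpen_ball
  have hne0 : ∀ z ∈ K, ‖z - b‖ ≠ 0 := fun z hz => by
    have : s ≤ ‖z - b‖ := by simpa [dist_eq_norm] using hz.2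
    linarith
  have hhcont : ContinuousOn h K := by
    have : ContinuousOn (fun z : ℂ => Real.log ‖z - b‖) K :=
      ContinuousOn.log (by fun_prop) hne0
    fun_prop
  have hfusc : UpperSemicontinuousOn (fun z => v z + ((-h z : ℝ) : EReal)) K := by
    refine (husc.mono hKR).add' ?_ fun z hz =>
      EReal.continuousAt_add (Or.inl (htop z (hKR hz))) (Or.inr (EReal.coe_ne_top _))
    exact (continuous_coe_real_ereal.comp_continuousOn hhcont.neg).upperSemicontinuousOn
  have hz₀K : z₀ ∈ K := ⟨ball_subset_closedBall hz₀, by simpa [dist_eq_norm] using hz₀s.le⟩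
  obtain ⟨c, hcK, hcmax⟩ := hfusc.exists_isMaxOn ⟨z₀, hz₀K⟩ hK
  have hz₀c : v z₀ + ((-h z₀ : ℝ) : EReal) ≤ v c + ((-h c : ℝ) : EReal) := hcmax hz₀K
  have hcbot : v c ≠ ⊥ := by
    intro hc
    rw [hc, EReal.bot_add, le_bot_iff, EReal.add_eq_bot_iff] at hz₀c
    exact hz₀c.elim hne (EReal.coe_ne_bot _)
  have hctop : v c ≠ ⊤ := htop c (hKR hcK)
  have hvc : ((v c).toReal : EReal) = v c := EReal.coe_toReal hctop hcbot
  have hvz₀ : ((v z₀).toReal : EReal) = v z₀ := EReal.coe_toReal hz₀top hne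
  have hmpos : 0 < (v c).toReal - h c := by
    rw [← hvc, ← hvz₀, ← EReal.coe_add, ← EReal.coe_add, EReal.coe_le_coe_iff] at hz₀c
    linarith
  have hmaj : ∀ z ∈ K, v z ≤ ((h z + ((v c).toReal - h c) : ℝ) : EReal) := by
    intro z hz
    by_cases hzb : v z = ⊥
    · rw [hzb]; exact bot_le
    have hzc : v z + ((-h z : ℝ) : EReal) ≤ v c + ((-h c : ℝ) : EReal) := hcmax hz
    have hvz : ((v z).toReal : EReal) = v z := EReal.coe_toReal (htop z (hKR hz)) hzb
    rw [← hvc, ← hvz, ← EReal.coe_add, ← EReal.coe_add, EReal.coe_le_coe_iff] at hzc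
    rw [← hvz, EReal.coe_le_coe_iff]
    linarith
  have hcR : ‖c - b‖ < R := by
    have hle : ‖c - b‖ ≤ R := by simpa [dist_eq_norm] using hcK.1
    refine lt_of_le_of_ne hle fun heq => ?_
    have hhc : h c = M := by simp [hh, hg, hgR, heq]
    have := hM c (hKR hcK)
    rw [← hvc, EReal.coe_le_coe_iff] at this
    linarith
  have hcs : s < ‖c - b‖ := by
    by_contra! hle
    exact hcbot (hbot c (by simpa [dist_eq_norm] using hle))
  have hsmall : ∀ᶠ r : ℝ in nhdsWithin 0 (Ioi 0), r < min (R - ‖c - b‖) (‖c - b‖ - s) :=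
    nhdsWithin_le_nhds (eventually_lt_nhds (lt_min (by linarith) (by linarith)))
  obtain ⟨r, ⟨hrsub, hrlt⟩, hrpos⟩ :=
    (((hsub c (by simpa [dist_eq_norm] using hcR) hcbot).and hsmall).and
      self_mem_nhdsWithin).exists
  replace hrpos : 0 < r := hrpos
  rw [lt_min_iff] at hrlt
  have hball : closedBall c r ⊆ K := by
    intro z hz
    have hz' : ‖z - c‖ ≤ r := by simpa [dist_eq_norm] using hz
    have h1 : ‖z - b‖ ≤ ‖z - c‖ + ‖c - b‖ := norm_sub_le_norm_sub_add_norm_sub z c b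
    have h2 : ‖c - b‖ ≤ ‖c - z‖ + ‖z - b‖ := norm_sub_le_norm_sub_add_norm_sub c z b
    rw [norm_sub_rev c z] at h2
    refine ⟨?_, ?_⟩
    · rw [mem_closedBall, dist_eq_norm]; linarith
    · rw [mem_ball, dist_eq_norm]; linarith
  have hcirc : ∀ θ : ℝ, c + r * Complex.exp (θ * Complex.I) ∈ K := fun θ => hball <| by
    simp [abs_of_pos hrpos, Complex.norm_exp_ofReal_mul_I]
  have hbc : b ∉ closedBall c r := fun hb => hne0 b (hball hb) (by simp)
  have key := hrsub (fun θ => (M - k * gR + ((v c).toReal - h c)) +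
      k * (Real.log ‖c + r * Complex.exp (θ * Complex.I) - b‖ -
        ε * ‖c + r * Complex.exp (θ * Complex.I) - b‖ ^ 2))
    (by
      have : Continuous fun θ : ℝ => Real.log ‖c + r * Complex.exp (θ * Complex.I) - b‖ :=
        Continuous.log (by fun_prop) fun θ => hne0 _ (hcirc θ)
      fun_prop)
    (fun θ => (hmaj _ (hcirc θ)).trans_eq (by
      congr 1
      simp only [hh, hg]
      ring))
  rw [mean_log_barrier hrpos hbc, ← hvc, EReal.coe_le_coe_iff] at key
  have : 0 < k * ε * r ^ 2 := by positivity
  simp only [hh, hg, EReal.toReal_coe] at key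
  linarith

/-- A function satisfying local sub-mean value inequalities on a connected open set that is `-∞`
on a nonempty open subset is identically `-∞`. -/
theorem eq_bot_of_eventually_eq_bot {v : ℂ → EReal} {D : Set ℂ} (hD : IsOpen D)
    (hconn : IsPreconnected D) (husc : UpperSemicontinuousOn v D) (htop : ∀ z ∈ D, v z ≠ ⊤)
    (hsub : ∀ c ∈ D, v c ≠ ⊥ → ∀ᶠ r in nhdsWithin 0 (Ioi 0), SubmeanOnCircle v c r)
    {a : ℂ} (ha : a ∈ D) (hbot : ∀ᶠ z in nhds a, v z = ⊥) :
    ∀ z ∈ D, v z = ⊥ := by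
  have hW : D ⊆ interior {z | v z = ⊥} := by
    refine hconn.subset_of_closure_inter_subset isOpen_interior
      ⟨a, ha, mem_interior_iff_mem_nhds.2 hbot⟩ ?_
    rintro p ⟨hpc, hpD⟩
    obtain ⟨δ, hδ, hball⟩ := Metric.isOpen_iff.1 hD p hpD
    obtain ⟨q, hq, hpq⟩ := Metric.mem_closure_iff.1 hpc (δ / 3) (by positivity)
    have hsubset : closedBall q (δ / 2) ⊆ D := fun z hz => hball <| by
      rw [mem_closedBall] at hz
      rw [mem_ball]
      have := dist_triangle z q p
      rw [dist_comm q p] at this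
      linarith
    obtain ⟨s, hs, hsq⟩ := Metric.nhds_basis_closedBall.mem_iff.1
      (mem_interior_iff_mem_nhds.1 hq)
    have hall := eq_bot_on_ball_of_eq_bot_on_closedBall hs (husc.mono hsubset)
      (fun z hz => htop z (hsubset hz))
      (fun c hc => hsub c (hsubset (ball_subset_closedBall hc))) hsq
    exact interior_maximal hall isOpen_ball (by rw [mem_ball]; linarith)
  exact fun z hz => (hW.trans interior_subset) hz

theorem SubmeanOn.eventually_submeanOnCircle {u : ℂ → EReal} {Ω : Set ℂ} (hu : SubmeanOn u Ω)
    (hΩ : IsOpen Ω) {c : ℂ} (hc : c ∈ Ω) :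
    ∀ᶠ r in nhdsWithin 0 (Ioi 0), SubmeanOnCircle u c r := by
  obtain ⟨δ, hδ, hball⟩ := Metric.isOpen_iff.1 hΩ c hc
  filter_upwards [self_mem_nhdsWithin, nhdsWithin_le_nhds (eventually_lt_nhds hδ)] with r hr hrδ
  exact hu c r hr ((closedBall_subset_ball hrδ).trans hball)

/-- A subharmonic function is not `-∞` on any nonempty open set. -/
theorem SubharmonicOn.not_eventually_eq_bot {u : ℂ → EReal} {Ω : Set ℂ} (hu : SubharmonicOn u Ω)
    {a : ℂ} (ha : a ∈ Ω) : ¬ ∀ᶠ z in nhds a, u z = ⊥ := by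
  obtain ⟨hΩ, husc, htop, hcomp, hsub⟩ := hu
  intro hbot
  obtain ⟨w, hw, hwbot⟩ := hcomp a ha
  have hss := connectedComponentIn_subset Ω a
  exact hwbot <| eq_bot_of_eventually_eq_bot hΩ.connectedComponentIn
    isPreconnected_connectedComponentIn (husc.mono hss) (fun z hz => htop z (hss hz))
    (fun c hc _ => hsub.eventually_submeanOnCircle hΩ (hss hc))
    (mem_connectedComponentIn ha) hbot w hw

open Classical in
/-- A subharmonic function on a disc whose non-`-∞` set is contained in the union of two disjoint
open sets cannot have both of them meeting the disc. -/
theorem SubharmonicOn.not_separated {u : ℂ → EReal} {Ω D A B : Set ℂ} (hu : SubharmonicOn u Ω)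
    (hD : IsOpen D) (hDconn : IsPreconnected D) (hDΩ : D ⊆ Ω) (hA : IsOpen A) (hB : IsOpen B)
    (hAB : Disjoint A B) (hcover : ∀ z ∈ D, u z ≠ ⊥ → z ∈ A ∪ B) (hDA : (D ∩ A).Nonempty)
    (hDB : (D ∩ B).Nonempty) : False := by
  set v : ℂ → EReal := fun z => if z ∈ A then u z else ⊥ with hv
  have hvA : ∀ z ∈ A, v z = u z := fun z hz => if_pos hz
  have hvnA : ∀ z ∉ A, v z = ⊥ := fun z hz => if_neg hz
  have hvB : ∀ z ∈ B, v z = ⊥ := fun z hz => hvnA z (hAB.notMem_of_mem_right hz)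
  have hvu : ∀ z, v z ≤ u z := fun z => by
    by_cases hz : z ∈ A
    · exact (hvA z hz).le
    · rw [hvnA z hz]; exact bot_le
  obtain ⟨b, hbD, hbB⟩ := hDB
  obtain ⟨a, haD, haA⟩ := hDA
  have hall : ∀ z ∈ D, v z = ⊥ := by
    refine eq_bot_of_eventually_eq_bot hD hDconn ?_ ?_ ?_ hbD
      (Filter.mem_of_superset (hB.mem_nhds hbB) hvB)
    · intro z hz y hy
      by_cases hzB : z ∈ B
      · filter_upwards [nhdsWithin_le_nhds (hB.mem_nhds hzB)] with w hw
        rw [hvB w hw]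
        exact bot_le.trans_lt hy
      · have huv : u z = v z := by
          by_cases hzA : z ∈ A
          · exact (hvA z hzA).symm
          · rw [hvnA z hzA]
            by_contra h
            exact (hcover z hz h).elim hzA hzB
        filter_upwards [hu.2.1.mono hDΩ z hz y (huv.trans_lt hy)] with w hw
        exact (hvu w).trans_lt hw
    · exact fun z hz => ((hvu z).trans_lt (hu.2.2.1 z (hDΩ hz)).lt_top).ne
    · intro c hc hcbot
      have hcA : c ∈ A := by
        by_contra h
        exact hcbot (hvnA c h)
      obtain ⟨δ, hδ, hball⟩ := Metric.isOpen_iff.1 hA c hcA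
      filter_upwards [hu.2.2.2.2.eventually_submeanOnCircle hu.1 (hDΩ hc), self_mem_nhdsWithin,
        nhdsWithin_le_nhds (eventually_lt_nhds hδ)] with r hr (hr0 : 0 < r) hrδ φ hφ hle
      rw [hvA c hcA]
      refine hr φ hφ fun θ => ?_
      rw [← hvA _ (hball _)]
      · exact hle θ
      · simpa [abs_of_pos hr0, Complex.norm_exp_ofReal_mul_I] using hrδ
  refine hu.not_eventually_eq_bot (hDΩ haD) ?_
  filter_upwards [hA.mem_nhds haA, hD.mem_nhds haD] with z hzA hzD
  rw [← hvA z hzA, hall z hzD]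

/-- Removing a relatively closed polar subset from a nonempty open
connected `V ⊆ ℂ` leaves a nonempty open connected set. -/
theorem diff_polar_connected (V : Set ℂ) (hVopen : IsOpen V) (hVconn : IsConnected V)
    (E : Set ℂ) (hEV : E ⊆ V) (hEpolar : PolarSet E) (hEclosed : closure E ∩ V ⊆ E) :
    IsOpen (V \ E) ∧ IsConnected (V \ E) := by
  obtain ⟨Ω, hEΩ, u, hu, huE⟩ := hEpolar
  have hopen : IsOpen (V \ E) := by
    have : V \ E = V \ closure E := Subset.antisymm
      (fun z hz => ⟨hz.1, fun h => hz.2 (hEclosed ⟨h, hz.1⟩)⟩)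
      (sdiff_subset_sdiff_right subset_closure)
    rw [this]
    exact hVopen.sdiff isClosed_closure
  have hdense : V ⊆ closure (V \ E) := by
    intro p hp
    by_contra hpc
    have hnear : ∀ᶠ z in nhds p, z ∈ E := by
      filter_upwards [hVopen.mem_nhds hp, isClosed_closure.isOpen_compl.mem_nhds hpc] with z hzV hzc
      by_contra hzE
      exact hzc (subset_closure ⟨hzV, hzE⟩)
    exact hu.not_eventually_eq_bot (hEΩ hnear.self_of_nhds) (hnear.mono huE)
  refine ⟨hopen, ?_, ?_⟩
  · exact closure_nonempty_iff.1 (hVconn.nonempty.mono hdense)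
  · intro A B hA hB hcover hneA hneB
    by_contra hempty
    have hdisj : Disjoint ((V \ E) ∩ A) ((V \ E) ∩ B) :=
      disjoint_left.2 fun z hz hz' => hempty ⟨z, hz.1, hz.2, hz'.2⟩
    have hA' : IsOpen ((V \ E) ∩ A) := hopen.inter hA
    have hB' : IsOpen ((V \ E) ∩ B) := hopen.inter hB
    have hunion : V \ E ⊆ ((V \ E) ∩ A) ∪ ((V \ E) ∩ B) := fun z hz =>
      (hcover hz).imp (fun h => ⟨hz, h⟩) (fun h => ⟨hz, h⟩)
    obtain ⟨p, hpV, hpA, hpB⟩ := isPreconnected_closed_iff.1 hVconn.isPreconnected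
      (closure ((V \ E) ∩ A)) (closure ((V \ E) ∩ B)) isClosed_closure isClosed_closure
      (by rw [← closure_union]; exact hdense.trans (closure_mono hunion))
      (hneA.mono fun z hz => ⟨hz.1.1, subset_closure hz⟩)
      (hneB.mono fun z hz => ⟨hz.1.1, subset_closure hz⟩)
    have hpE : p ∈ E := by
      by_contra hpE
      rcases hunion ⟨hpV, hpE⟩ with hp | hp
      · exact (hdisj.closure_right hA').notMem_of_mem_left hp hpB
      · exact (hdisj.closure_left hB').notMem_of_mem_left hpA hp
    obtain ⟨ρ, hρ, hball⟩ := Metric.isOpen_iff.1 (hVopen.inter hu.1) p ⟨hpV, hEΩ hpE⟩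
    refine hu.not_separated isOpen_ball (convex_ball p ρ).isPreconnected
      (hball.trans inter_subset_right) hA' hB' hdisj ?_ ?_ ?_
    · exact fun z hz hzbot => hunion ⟨(hball hz).1, fun hzE => hzbot (huE z hzE)⟩
    · exact mem_closure_iff.1 hpA _ isOpen_ball (mem_ball_self hρ)
    · exact mem_closure_iff.1 hpB _ isOpen_ball (mem_ball_self hρ)
end

section
/- Let D ⊂ ℂ be a domain and let ρ : D → [-∞,∞) be a subharmonic function that is bounded from below. Then D̂ is a domain (open and connected) with D ⊆ D̂ ⊆ D ∪ S(D), the set D̂ \ D is polar, and ρ̂ is subharmonic on D̂. -/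
open MeasureTheory Filter Metric Set

open scoped Topology
open InnerProductSpace

/-- The sub-mean value inequality for `u` over the circle of centre `c` and radius `r`. -/
def CircleSubmean (u : ℂ → EReal) (c : ℂ) (r : ℝ) : Prop :=
  ∀ φ : ℝ → ℝ, Continuous φ → (∀ θ : ℝ, u (circleMap c r θ) ≤ ((φ θ : ℝ) : EReal)) →
    u c ≤ (((2 * Real.pi)⁻¹ * ∫ θ in (0:ℝ)..(2 * Real.pi), φ θ : ℝ) : EReal)

theorem SubmeanOn.circleSubmean {u : ℂ → EReal} {Ω : Set ℂ} (h : SubmeanOn u Ω) {c : ℂ} {r : ℝ}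
    (hr : 0 < r) (hc : closedBall c r ⊆ Ω) : CircleSubmean u c r :=
  h c r hr hc

/-- A function bounded by `K` on a circle, and by `K - d` on an arc, is at most `K - d * β` at the
centre, where `β` depends only on the arc. -/
theorem CircleSubmean.exists_le_sub_mul {θ₀ ε : ℝ} (hθ₀ : θ₀ ∈ Icc 0 (2 * Real.pi)) (hε : 0 < ε) :
    ∃ β : ℝ, 0 < β ∧ ∀ (u : ℂ → EReal) (c : ℂ) (r K d : ℝ), 0 ≤ d → CircleSubmean u c r →
      (∀ θ, u (circleMap c r θ) ≤ K) →
      (∀ θ, |θ - θ₀| < ε → u (circleMap c r θ) ≤ ((K - d : ℝ) : EReal)) →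
      u c ≤ ((K - d * β : ℝ) : EReal) := by
  set b : ℝ → ℝ := fun θ => max 0 (1 - |θ - θ₀| / ε) with hb
  have hbc : Continuous b := by fun_prop
  have hI : 0 < ∫ θ in (0:ℝ)..(2 * Real.pi), b θ := by
    refine intervalIntegral.integral_pos Real.two_pi_pos hbc.continuousOn
      (fun θ _ => le_max_left _ _) ⟨θ₀, hθ₀, ?_⟩
    simp [hb]
  refine ⟨(2 * Real.pi)⁻¹ * ∫ θ in (0:ℝ)..(2 * Real.pi), b θ, by positivity, ?_⟩
  intro u c r K d hd hu hK hKd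
  refine (hu (fun θ => K - d * b θ) (by fun_prop) fun θ => ?_).trans_eq ?_
  · by_cases h : |θ - θ₀| < ε
    · refine (hKd θ h).trans (EReal.coe_le_coe_iff.2 ?_)
      have : b θ ≤ 1 := max_le zero_le_one (by simp; positivity)
      nlinarith
    · have : b θ = 0 := by
        refine max_eq_left ?_
        rw [sub_nonpos, le_div_iff₀ hε]
        linarith
      simpa [this] using hK θ
  · congr 1
    rw [intervalIntegral.integral_sub (by simp)
      ((hbc.const_mul d |>.congr fun _ => rfl).intervalIntegrable _ _),
      intervalIntegral.integral_const_mul, intervalIntegral.integral_const]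
    have := Real.pi_pos
    simp only [smul_eq_mul]
    field_simp
    ring

theorem UpperSemicontinuousOn.exists_forall_le_coe {q : ℂ → EReal} {X : Set ℂ}
    (husc : UpperSemicontinuousOn q X) (hX : IsCompact X) (htop : ∀ z ∈ X, q z ≠ ⊤) :
    ∃ K : ℝ, ∀ z ∈ X, q z ≤ K := by
  rcases X.eq_empty_or_nonempty with rfl | hne
  · exact ⟨0, by simp⟩
  · obtain ⟨w, hw, hmax⟩ := husc.exists_isMaxOn hne hX
    exact ⟨(q w).toReal, fun y hy => (hmax hy).trans (EReal.le_coe_toReal (htop w hw))⟩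

/-- The maximum principle on a compact set: a function that satisfies the sub-mean value inequality
wherever it exceeds `C` is at most `C`. -/
theorem le_of_circleSubmean {q : ℂ → EReal} {X : Set ℂ} (hX : IsCompact X)
    (husc : UpperSemicontinuousOn q X) (htop : ∀ z ∈ X, q z ≠ ⊤) {C : ℝ}
    (h : ∀ z ∈ X, (C : EReal) < q z → ∃ r > 0, closedBall z r ⊆ X ∧ CircleSubmean q z r) :
    ∀ z ∈ X, q z ≤ C := by
  by_contra! hcon
  obtain ⟨z₀, hz₀, hCz₀⟩ := hcon
  obtain ⟨z₁, hz₁, hmax⟩ := husc.exists_isMaxOn ⟨z₀, hz₀⟩ hX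
  have hCz₁ : (C : EReal) < q z₁ := hCz₀.trans_le (hmax hz₀)
  obtain ⟨m, hm⟩ : ∃ m : ℝ, q z₁ = m := by
    lift q z₁ to ℝ using ⟨htop _ hz₁, (bot_lt_of_lt hCz₁).ne'⟩ with m
    exact ⟨m, rfl⟩
  have hle : ∀ z ∈ X, q z ≤ m := fun z hz => hm ▸ hmax hz
  obtain ⟨z, ⟨hzX, hzm⟩, hzmin⟩ := (husc.isCompact_inter_preimage_Ici hX (m : EReal)).exists_isMinOn
    ⟨z₁, hz₁, hm.ge⟩ Complex.continuous_re.continuousOn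
  have hqz : q z = m := le_antisymm (hle z hzX) hzm
  obtain ⟨r, hr, hball, hsub⟩ := h z hzX (by rw [hqz, ← hm]; exact hCz₁)
  have hcirc : ∀ θ, circleMap z r θ ∈ X := fun θ => hball (circleMap_mem_closedBall z hr.le θ)
  have hlt : q (circleMap z r Real.pi) < m := by
    by_contra! hge
    have := hzmin ⟨hcirc Real.pi, hge⟩
    simp [circleMap] at this
    linarith
  obtain ⟨m', hm', hm'm⟩ := EReal.lt_iff_exists_real_btwn.1 hlt
  have hev : ∀ᶠ θ in 𝓝 Real.pi, q (circleMap z r θ) < m' := by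
    have ht : Tendsto (circleMap z r) (𝓝 Real.pi) (𝓝[X] (circleMap z r Real.pi)) :=
      tendsto_nhdsWithin_iff.2 ⟨(continuous_circleMap z r).tendsto _, Eventually.of_forall hcirc⟩
    exact ht.eventually (husc _ (hcirc _) _ hm')
  obtain ⟨ε, hε, hεm⟩ := Metric.eventually_nhds_iff.1 hev
  obtain ⟨β, hβ, hB⟩ := CircleSubmean.exists_le_sub_mul (θ₀ := Real.pi)
    ⟨Real.pi_pos.le, by linarith [Real.pi_pos]⟩ hε
  have hm'm := EReal.coe_lt_coe_iff.1 hm'm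
  have := hB q z r m (m - m') (by linarith) hsub (fun θ => hle _ (hcirc θ)) (fun θ hθ => by
    simpa using (hεm (by rwa [Real.dist_eq])).le)
  rw [hqz, EReal.coe_le_coe_iff] at this
  nlinarith

/-- A subharmonic function is not identically `-∞` on any disc. -/
theorem SubharmonicOn.exists_ne_bot {u : ℂ → EReal} {Ω : Set ℂ} (hu : SubharmonicOn u Ω) {z : ℂ}
    (hz : z ∈ Ω) {U : Set ℂ} (hU : U ∈ 𝓝 z) : ∃ w ∈ U, w ∈ Ω ∧ u w ≠ ⊥ := by
  obtain ⟨hΩ, husc, htop, hbot, hsub⟩ := hu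
  by_contra! hcon
  set A : Set ℂ := interior {w | w ∈ Ω → u w = ⊥} with hA
  have hzA : z ∈ A := mem_interior_iff_mem_nhds.2 (by filter_upwards [hU] with w hw using hcon w hw)
  have hcl : closure A ∩ connectedComponentIn Ω z ⊆ A := by
    rintro x ⟨hxA, hxC⟩
    have hxΩ : x ∈ Ω := connectedComponentIn_subset _ _ hxC
    obtain ⟨R, hR, hRΩ⟩ := Metric.nhds_basis_closedBall.mem_iff.1 (hΩ.mem_nhds hxΩ)
    obtain ⟨a, haA, hax⟩ := Metric.mem_closure_iff.1 hxA (R / 4) (by positivity)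
    obtain ⟨K, hK⟩ := UpperSemicontinuousOn.exists_forall_le_coe (husc.mono hRΩ)
      (isCompact_closedBall x R) fun w hw => htop w (hRΩ hw)
    refine mem_interior_iff_mem_nhds.2 ?_
    filter_upwards [Metric.ball_mem_nhds x (show 0 < R / 4 by positivity)] with c hc hcΩ
    by_cases hca : c = a
    · subst hca
      exact interior_subset haA hcΩ
    have hr : 0 < dist a c := dist_pos.2 (Ne.symm hca)
    have hcx : dist c x < R / 4 := hc
    have hcb : closedBall c (dist a c) ⊆ closedBall x R := by
      refine closedBall_subset_closedBall' ?_
      have := dist_triangle a x c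
      rw [dist_comm x a] at hax
      rw [dist_comm x c] at this
      linarith
    obtain ⟨θ₀, hθ₀, hθa⟩ : ∃ θ₀ ∈ Icc 0 (2 * Real.pi), circleMap c (dist a c) θ₀ = a := by
      have : a ∈ sphere c |dist a c| := by simp [Complex.dist_eq]
      rw [← image_circleMap_Ioc] at this
      obtain ⟨θ, hθ, h⟩ := this
      exact ⟨θ, Ioc_subset_Icc_self hθ, h⟩
    have hev : ∀ᶠ θ in 𝓝 θ₀, circleMap c (dist a c) θ ∈ A :=
      (continuous_circleMap c _).continuousAt.eventually_mem
        (by rw [hθa]; exact isOpen_interior.mem_nhds haA)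
    obtain ⟨ε, hε, hεm⟩ := Metric.eventually_nhds_iff.1 hev
    obtain ⟨β, hβ, hB⟩ := CircleSubmean.exists_le_sub_mul hθ₀ hε
    have hcirc : ∀ θ, circleMap c (dist a c) θ ∈ closedBall x R :=
      fun θ => hcb (circleMap_mem_closedBall c hr.le θ)
    refine EReal.eq_bot_iff_forall_lt _ |>.2 fun y => ?_
    set d := max 0 ((K - y + 1) / β)
    have hd : K - d * β < y := by
      have : (K - y + 1) / β ≤ d := le_max_right _ _
      rw [div_le_iff₀ hβ] at this
      linarith
    refine lt_of_le_of_lt (hB u c _ K d (le_max_left _ _)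
      (hsub.circleSubmean hr (hcb.trans hRΩ)) (fun θ => hK _ (hcirc θ)) fun θ hθ => ?_)
      (EReal.coe_lt_coe_iff.2 hd)
    rw [interior_subset (hεm (by rwa [Real.dist_eq])) (hRΩ (hcirc θ))]
    exact bot_le
  have hall := isPreconnected_connectedComponentIn.subset_of_closure_inter_subset isOpen_interior
    ⟨z, mem_connectedComponentIn hz, hzA⟩ hcl
  obtain ⟨w, hw, hwb⟩ := hbot z hz
  exact hwb (interior_subset (hall hw) (connectedComponentIn_subset _ _ hw))

theorem CircleSubmean.add_harmonic {u : ℂ → EReal} {c : ℂ} {r : ℝ} (hu : CircleSubmean u c r)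
    (hr : 0 < r) {h : ℂ → ℝ} (hh : HarmonicOnNhd h (closedBall c r)) :
    CircleSubmean (fun z => u z + (h z : EReal)) c r := by
  intro φ hφ hle
  have hcont : Continuous fun θ => h (circleMap c r θ) := by
    refine ContinuousOn.comp_continuous (s := closedBall c r) ?_ (continuous_circleMap c r)
      fun θ => circleMap_mem_closedBall c hr.le θ
    exact fun z hz => (hh z hz).1.continuousAt.continuousWithinAt
  have hmean : (2 * Real.pi)⁻¹ * ∫ θ in (0:ℝ)..(2 * Real.pi), h (circleMap c r θ) = h c := by
    have := InnerProductSpace.HarmonicOnNhd.circleAverage_eq (f := h) (c := c) (R := r)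
      (by rwa [abs_of_pos hr])
    rwa [Real.circleAverage_def, smul_eq_mul] at this
  have key := hu (fun θ => φ θ - h (circleMap c r θ)) (hφ.sub hcont) fun θ => by
    rw [EReal.coe_sub]
    exact EReal.le_sub_iff_add_le (by simp) (by simp) |>.2 (hle θ)
  rw [intervalIntegral.integral_sub (hφ.intervalIntegrable _ _) (hcont.intervalIntegrable _ _),
    mul_sub, hmean, EReal.coe_sub, EReal.le_sub_iff_add_le (by simp) (by simp)] at key
  exact key

theorem CircleSubmean.const_mul {u : ℂ → EReal} {c : ℂ} {r : ℝ} (hu : CircleSubmean u c r)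
    {δ : ℝ} (hδ : 0 < δ) : CircleSubmean (fun z => (δ : EReal) * u z) c r := by
  intro φ hφ hle
  have hiff : ∀ (x : EReal) (y : ℝ), (δ : EReal) * x ≤ y ↔ x ≤ ((δ⁻¹ * y : ℝ) : EReal) := by
    intro x y
    have := EReal.le_div_iff_mul_le (a := x) (b := (δ : EReal)) (c := y)
      (EReal.coe_pos.2 hδ) (EReal.coe_ne_top _)
    rw [mul_comm, ← this, mul_comm δ⁻¹, ← div_eq_mul_inv, EReal.coe_div]
  have key := hu (fun θ => δ⁻¹ * φ θ) (hφ.const_mul _ |>.congr fun _ => rfl)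
    fun θ => (hiff _ _).1 (hle θ)
  rw [hiff]
  rw [intervalIntegral.integral_const_mul] at key
  convert key using 2
  ring

/-- Continuous majorants of a sum of two semicontinuous functions split. -/
theorem exists_continuous_add_le {f g : ℝ → EReal} (hf : UpperSemicontinuous f)
    (hg : UpperSemicontinuous g) (hgt : ∀ θ, g θ ≠ ⊤) {ψ : ℝ → ℝ} (hψ : Continuous ψ)
    (hlt : ∀ θ, f θ + g θ < ψ θ) (hft : ∀ θ, f θ ≠ ⊤) :
    ∃ φ₁ φ₂ : ℝ → ℝ, Continuous φ₁ ∧ Continuous φ₂ ∧ (∀ θ, f θ ≤ φ₁ θ) ∧ (∀ θ, g θ ≤ φ₂ θ) ∧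
      ∀ θ, φ₁ θ + φ₂ θ ≤ ψ θ := by
  obtain ⟨φ, hφ⟩ := exists_continuous_forall_mem_convex_of_local_const
    (t := fun θ => {p : ℝ × ℝ | f θ ≤ p.1 ∧ g θ ≤ p.2 ∧ p.1 + p.2 ≤ ψ θ}) (fun θ => by
      have h1 : Convex ℝ {x : ℝ | f θ ≤ x} := by
        refine Set.OrdConnected.convex ⟨fun x hx y hy z hz => ?_⟩
        exact le_trans hx (EReal.coe_le_coe_iff.2 hz.1)
      have h2 : Convex ℝ {x : ℝ | g θ ≤ x} := by
        refine Set.OrdConnected.convex ⟨fun x hx y hy z hz => ?_⟩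
        exact le_trans hx (EReal.coe_le_coe_iff.2 hz.1)
      intro p hp q hq a b ha hb hab
      refine ⟨h1 hp.1 hq.1 ha hb hab, h2 hp.2.1 hq.2.1 ha hb hab, ?_⟩
      have hp3 := hp.2.2
      have hq3 := hq.2.2
      simp only [Prod.fst_add, Prod.smul_fst, smul_eq_mul, Prod.snd_add, Prod.smul_snd]
      calc a * p.1 + b * q.1 + (a * p.2 + b * q.2) = a * (p.1 + p.2) + b * (q.1 + q.2) := by ring
        _ ≤ a * ψ θ + b * ψ θ := by gcongr
        _ = ψ θ := by rw [← add_mul, hab, one_mul]) (fun θ => by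
      obtain ⟨a, b, ha, hb, hab⟩ : ∃ a b : ℝ, f θ < a ∧ g θ < b ∧ a + b < ψ θ := by
        have hfθ := hft θ
        have hgθ := hgt θ
        have h := hlt θ
        generalize f θ = x at hfθ h ⊢
        generalize g θ = y at hgθ h ⊢
        induction x with
        | top => exact (hfθ rfl).elim
        | bot =>
          induction y with
          | top => exact (hgθ rfl).elim
          | bot => exact ⟨ψ θ - 1, 0, EReal.bot_lt_coe _, EReal.bot_lt_coe _, by linarith⟩
          | coe y => exact ⟨ψ θ - y - 2, y + 1, EReal.bot_lt_coe _,
              EReal.coe_lt_coe_iff.2 (by linarith), by linarith⟩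
        | coe x =>
          induction y with
          | top => exact (hgθ rfl).elim
          | bot => exact ⟨x + 1, ψ θ - x - 2, EReal.coe_lt_coe_iff.2 (by linarith),
              EReal.bot_lt_coe _, by linarith⟩
          | coe y =>
            rw [← EReal.coe_add, EReal.coe_lt_coe_iff] at h
            exact ⟨x + (ψ θ - x - y) / 3, y + (ψ θ - x - y) / 3,
              EReal.coe_lt_coe_iff.2 (by linarith), EReal.coe_lt_coe_iff.2 (by linarith),
              by linarith⟩
      refine ⟨(a, b), ?_⟩
      filter_upwards [hf θ _ ha, hg θ _ hb, hψ.continuousAt.eventually (lt_mem_nhds hab)]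
        with y h1 h2 h3
      exact ⟨h1.le, h2.le, le_of_lt h3⟩)
  exact ⟨fun θ => (φ θ).1, fun θ => (φ θ).2, by fun_prop, by fun_prop, fun θ => (hφ θ).1,
    fun θ => (hφ θ).2.1, fun θ => (hφ θ).2.2⟩

theorem UpperSemicontinuousOn.comp_circleMap {u : ℂ → EReal} {c : ℂ} {r : ℝ} (hr : 0 < r)
    (hu : UpperSemicontinuousOn u (closedBall c r)) :
    UpperSemicontinuous fun θ => u (circleMap c r θ) := by
  intro θ y hy
  have hcirc : ∀ θ, circleMap c r θ ∈ closedBall c r := circleMap_mem_closedBall c hr.le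
  have ht : Tendsto (circleMap c r) (𝓝 θ) (𝓝[closedBall c r] (circleMap c r θ)) :=
    tendsto_nhdsWithin_iff.2 ⟨(continuous_circleMap c r).tendsto _, Eventually.of_forall hcirc⟩
  exact ht.eventually (hu _ (hcirc _) _ hy)

theorem CircleSubmean.add {u v : ℂ → EReal} {c : ℂ} {r : ℝ} (hr : 0 < r)
    (hu : CircleSubmean u c r) (hv : CircleSubmean v c r)
    (huc : UpperSemicontinuousOn u (closedBall c r))
    (hvc : UpperSemicontinuousOn v (closedBall c r))
    (hut : ∀ z ∈ closedBall c r, u z ≠ ⊤) (hvt : ∀ z ∈ closedBall c r, v z ≠ ⊤) :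
    CircleSubmean (fun z => u z + v z) c r := by
  intro φ hφ hle
  have hcirc : ∀ θ, circleMap c r θ ∈ closedBall c r := circleMap_mem_closedBall c hr.le
  refine EReal.le_of_forall_lt_iff_le.1 fun t ht => ?_
  set I := (2 * Real.pi)⁻¹ * ∫ θ in (0:ℝ)..(2 * Real.pi), φ θ with hI
  have ht := EReal.coe_lt_coe_iff.1 ht
  obtain ⟨φ₁, φ₂, h1, h2, hu1, hv2, hs⟩ := exists_continuous_add_le
    (f := fun θ => u (circleMap c r θ)) (g := fun θ => v (circleMap c r θ))
    (huc.comp_circleMap hr) (hvc.comp_circleMap hr) (fun θ => hvt _ (hcirc θ))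
    (ψ := fun θ => φ θ + (t - I)) (by fun_prop) (fun θ => (hle θ).trans_lt
      (EReal.coe_lt_coe_iff.2 (by linarith))) (fun θ => hut _ (hcirc θ))
  refine (add_le_add (hu φ₁ h1 hu1) (hv φ₂ h2 hv2)).trans ?_
  rw [← EReal.coe_add, EReal.coe_le_coe_iff, ← mul_add, ← intervalIntegral.integral_add
    (h1.intervalIntegrable _ _) (h2.intervalIntegrable _ _)]
  have hmono : ∫ θ in (0:ℝ)..(2 * Real.pi), (φ₁ θ + φ₂ θ) ≤
      ∫ θ in (0:ℝ)..(2 * Real.pi), (φ θ + (t - I)) :=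
    intervalIntegral.integral_mono_on Real.two_pi_pos.le ((h1.add h2).intervalIntegrable _ _)
      ((hφ.add continuous_const).intervalIntegrable _ _) fun θ _ => hs θ
  rw [intervalIntegral.integral_add (hφ.intervalIntegrable _ _) (by simp),
    intervalIntegral.integral_const, smul_eq_mul, sub_zero] at hmono
  have hpi := Real.pi_pos
  calc (2 * Real.pi)⁻¹ * ∫ θ in (0:ℝ)..(2 * Real.pi), (φ₁ θ + φ₂ θ)
      ≤ (2 * Real.pi)⁻¹ * ((∫ θ in (0:ℝ)..(2 * Real.pi), φ θ) + 2 * Real.pi * (t - I)) := by gcongr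
    _ = I + (t - I) := by rw [hI]; field_simp
    _ = t := by ring

theorem harmonicAt_re_of_differentiable {f : ℂ → ℂ} (hf : Differentiable ℂ f) (z : ℂ) :
    HarmonicAt (fun z => (f z).re) z :=
  (hf.analyticAt z).harmonicAt_re

theorem UpperSemicontinuousOn.add_coe {u : ℂ → EReal} {X : Set ℂ} (hu : UpperSemicontinuousOn u X)
    {h : ℂ → ℝ} (hh : ContinuousOn h X) :
    UpperSemicontinuousOn (fun z => u z + (h z : EReal)) X :=
  hu.add' (continuous_coe_real_ereal.comp_continuousOn hh).upperSemicontinuousOn fun z _ =>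
    EReal.continuousAt_add (by simp) (by simp)

theorem UpperSemicontinuousOn.add_ereal {u v : ℂ → EReal} {X : Set ℂ}
    (hu : UpperSemicontinuousOn u X) (hv : UpperSemicontinuousOn v X) (hut : ∀ z ∈ X, u z ≠ ⊤)
    (hvt : ∀ z ∈ X, v z ≠ ⊤) : UpperSemicontinuousOn (fun z => u z + v z) X :=
  hu.add' hv fun z hz => EReal.continuousAt_add (by simp [hut z hz]) (by simp [hvt z hz])

theorem UpperSemicontinuousOn.const_mul_ereal {u : ℂ → EReal} {X : Set ℂ}
    (hu : UpperSemicontinuousOn u X) {δ : ℝ} (hδ : 0 < δ) :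
    UpperSemicontinuousOn (fun z => (δ : EReal) * u z) X := by
  refine Continuous.comp_upperSemicontinuousOn (g := fun x : EReal => (δ : EReal) * x) ?_ hu ?_
  · refine continuous_iff_continuousAt.2 fun x => ?_
    exact (EReal.continuousAt_mul (p := ((δ : EReal), x)) (by simp [hδ.ne']) (by simp [hδ.ne'])
      (by simp) (by simp)).comp (by fun_prop : ContinuousAt (fun x : EReal => ((δ : EReal), x)) x)
  · exact fun x y hxy => mul_le_mul_of_nonneg_left hxy (EReal.coe_nonneg.2 hδ.le)

theorem exists_entire_of_mem_span_fourier {g : C(AddCircle (2 * Real.pi), ℂ)}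
    (hg : g ∈ Submodule.span ℂ (range (fourier (T := 2 * Real.pi)))) :
    ∃ P Q : ℂ → ℂ, Differentiable ℂ P ∧ Differentiable ℂ Q ∧ ∀ θ : ℝ, g θ =
      P (Complex.exp (θ * Complex.I)) + (starRingEnd ℂ) (Q (Complex.exp (θ * Complex.I))) := by
  have hpow : ∀ (n : ℕ) (θ : ℝ), fourier (T := 2 * Real.pi) n (θ : AddCircle (2 * Real.pi)) =
      Complex.exp (θ * Complex.I) ^ n := by
    intro n θ
    rw [fourier_coe_apply, ← Complex.exp_nat_mul]
    congr 1
    have : (Real.pi : ℂ) ≠ 0 := by exact_mod_cast Real.pi_ne_zero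
    push_cast
    field_simp
  induction hg using Submodule.span_induction with
  | mem x h =>
    obtain ⟨n, rfl⟩ := h
    rcases Int.eq_nat_or_neg n with ⟨m, rfl | rfl⟩
    · exact ⟨fun z => z ^ m, 0, by fun_prop, differentiable_const 0, fun θ => by simp [hpow]⟩
    · refine ⟨0, fun z => z ^ m, differentiable_const 0, by fun_prop, fun θ => ?_⟩
      rw [fourier_neg, hpow]
      simp
  | zero => exact ⟨0, 0, differentiable_const 0, differentiable_const 0, by simp⟩
  | add x y _ _ hx hy =>
    obtain ⟨P, Q, hP, hQ, h⟩ := hx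
    obtain ⟨P', Q', hP', hQ', h'⟩ := hy
    refine ⟨P + P', Q + Q', hP.add hP', hQ.add hQ', fun θ => ?_⟩
    simp only [ContinuousMap.add_apply, h, h', Pi.add_apply, map_add]
    ring
  | smul a x _ hx =>
    obtain ⟨P, Q, hP, hQ, h⟩ := hx
    refine ⟨fun z => a * P z, fun z => (starRingEnd ℂ) a * Q z, hP.const_mul a, hQ.const_mul _,
      fun θ => ?_⟩
    simp only [ContinuousMap.smul_apply, h, smul_eq_mul, map_mul, Complex.conj_conj]
    ring

/-- A continuous function on `[0, 2π]` has a majorant with equal values at the end points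
and almost the same integral. -/
theorem exists_continuous_majorant_endpoints {φ : ℝ → ℝ} (hφ : Continuous φ) {ε : ℝ} (hε : 0 < ε) :
    ∃ ψ : ℝ → ℝ, Continuous ψ ∧ ψ 0 = ψ (2 * Real.pi) ∧
      (∀ θ ∈ Icc 0 (2 * Real.pi), φ θ ≤ ψ θ) ∧
      (2 * Real.pi)⁻¹ * ∫ θ in (0:ℝ)..(2 * Real.pi), ψ θ ≤
        (2 * Real.pi)⁻¹ * (∫ θ in (0:ℝ)..(2 * Real.pi), φ θ) + ε := by
  have hpi := Real.two_pi_pos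
  set M := max (φ 0) (φ (2 * Real.pi)) with hM
  set α := M - φ 0 with hα
  set γ := M - φ (2 * Real.pi) with hγ
  have hα0 : 0 ≤ α := sub_nonneg.2 (le_max_left _ _)
  have hγ0 : 0 ≤ γ := sub_nonneg.2 (le_max_right _ _)
  obtain ⟨n, hn⟩ := exists_nat_gt ((α + γ) / ε)
  have hw1 : ∫ θ in (0:ℝ)..(2 * Real.pi), (1 - θ / (2 * Real.pi)) ^ (n + 1) =
      2 * Real.pi * (1 / (n + 2)) := by
    rw [intervalIntegral.integral_comp_sub_div (fun x => x ^ (n + 1)) hpi.ne' 1,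
      div_self hpi.ne', integral_pow]
    simp
    ring
  have hw2 : ∫ θ in (0:ℝ)..(2 * Real.pi), (θ / (2 * Real.pi)) ^ (n + 1) =
      2 * Real.pi * (1 / (n + 2)) := by
    rw [intervalIntegral.integral_comp_div (fun x => x ^ (n + 1)) hpi.ne',
      div_self hpi.ne', integral_pow]
    simp
    ring
  refine ⟨fun θ => φ θ + (α * (1 - θ / (2 * Real.pi)) ^ (n + 1) + γ * (θ / (2 * Real.pi)) ^ (n + 1)),
    by fun_prop, ?_, fun θ hθ => ?_, ?_⟩
  · simp [hpi.ne', hα, hγ]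
  · have h1 : 0 ≤ 1 - θ / (2 * Real.pi) := by
      rw [sub_nonneg, div_le_one hpi]
      exact hθ.2
    have h2 : 0 ≤ θ / (2 * Real.pi) := div_nonneg hθ.1 hpi.le
    have : 0 ≤ α * (1 - θ / (2 * Real.pi)) ^ (n + 1) + γ * (θ / (2 * Real.pi)) ^ (n + 1) := by
      positivity
    linarith
  · have hi1 : IntervalIntegrable (fun θ : ℝ => α * (1 - θ / (2 * Real.pi)) ^ (n + 1)) volume 0
        (2 * Real.pi) := Continuous.intervalIntegrable (by fun_prop) _ _
    have hi2 : IntervalIntegrable (fun θ : ℝ => γ * (θ / (2 * Real.pi)) ^ (n + 1)) volume 0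
        (2 * Real.pi) := Continuous.intervalIntegrable (by fun_prop) _ _
    rw [intervalIntegral.integral_add (hφ.intervalIntegrable _ _) (hi1.add hi2),
      intervalIntegral.integral_add hi1 hi2, intervalIntegral.integral_const_mul,
      intervalIntegral.integral_const_mul, hw1, hw2, mul_add]
    have hle : (α + γ) / (n + 2) ≤ ε := by
      rw [div_lt_iff₀ hε] at hn
      rw [div_le_iff₀ (by positivity)]
      nlinarith
    have : (2 * Real.pi)⁻¹ * (α * (2 * Real.pi * (1 / (n + 2))) + γ * (2 * Real.pi * (1 / (n + 2))))
        = (α + γ) / (n + 2) := by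
      field_simp
    linarith

/-- A continuous majorant on a circle is, up to `ε`, the restriction of a function harmonic on the
whole plane. -/
theorem exists_harmonic_majorant {u : ℂ → EReal} {c : ℂ} {r : ℝ} (hr : 0 < r) {φ : ℝ → ℝ}
    (hφ : Continuous φ) (hle : ∀ θ, u (circleMap c r θ) ≤ φ θ) {ε : ℝ} (hε : 0 < ε) :
    ∃ h : ℂ → ℝ, (∀ z, HarmonicAt h z) ∧ (∀ z ∈ sphere c r, u z ≤ h z) ∧
      h c ≤ (2 * Real.pi)⁻¹ * (∫ θ in (0:ℝ)..(2 * Real.pi), φ θ) + ε := by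
  have hpi := Real.two_pi_pos
  have : Fact (0 < 2 * Real.pi) := ⟨hpi⟩
  obtain ⟨ψ, hψ, hψe, hφψ, hψI⟩ := exists_continuous_majorant_endpoints hφ (half_pos hε)
  set Ψ : AddCircle (2 * Real.pi) → ℝ := AddCircle.liftIco (2 * Real.pi) 0 ψ with hΨ
  have hΨc : Continuous Ψ := AddCircle.liftIco_continuous (by simpa using hψe) hψ.continuousOn
  have hΨv : ∀ θ ∈ Icc 0 (2 * Real.pi), Ψ (θ : AddCircle (2 * Real.pi)) = ψ θ := by
    intro θ hθ
    rcases hθ.2.lt_or_eq with h | h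
    · exact AddCircle.liftIco_zero_coe_apply ⟨hθ.1, h⟩
    · rw [h, AddCircle.coe_period, ← hψe]
      exact AddCircle.liftIco_zero_coe_apply ⟨le_rfl, hpi⟩
  set G : C(AddCircle (2 * Real.pi), ℂ) := ⟨fun x => (Ψ x : ℂ), by fun_prop⟩ with hG
  have hGmem : G ∈ (Submodule.span ℂ (range (fourier (T := 2 * Real.pi)))).topologicalClosure := by
    rw [span_fourier_closure_eq_top]
    trivial
  obtain ⟨g, hg, hGg⟩ := Metric.mem_closure_iff.1 hGmem (ε / 4) (by positivity)
  obtain ⟨P, Q, hP, hQ, hPQ⟩ := exists_entire_of_mem_span_fourier hg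
  have happ : ∀ θ ∈ Icc 0 (2 * Real.pi),
      |ψ θ - ((P + Q) (Complex.exp (θ * Complex.I))).re| < ε / 4 := by
    intro θ hθ
    have h1 := (ContinuousMap.dist_apply_le_dist (f := G) (g := g) (θ : AddCircle _)).trans_lt hGg
    rw [Complex.dist_eq] at h1
    refine lt_of_le_of_lt ?_ h1
    have h2 := Complex.abs_re_le_norm (G θ - g θ)
    have h3 : (G θ - g θ).re = ψ θ - ((P + Q) (Complex.exp (θ * Complex.I))).re := by
      rw [hPQ]
      simp [hG, hΨv θ hθ]
    rwa [h3] at h2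
  set F : ℂ → ℂ := fun z => (P + Q) ((z - c) / r) + (ε / 4 : ℝ) with hF
  have hFd : Differentiable ℂ F := by
    have h1 : Differentiable ℂ fun z : ℂ => (z - c) / r := by fun_prop
    exact ((hP.add hQ).comp h1).add_const _
  have hrc : (r : ℂ) ≠ 0 := by exact_mod_cast hr.ne'
  have hFv : ∀ θ : ℝ, (F (circleMap c r θ)).re =
      ((P + Q) (Complex.exp (θ * Complex.I))).re + ε / 4 := by
    intro θ
    simp [hF, circleMap, hrc]
  refine ⟨fun z => (F z).re, harmonicAt_re_of_differentiable hFd, fun z hz => ?_, ?_⟩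
  · rw [← abs_of_pos hr, ← image_circleMap_Ioc] at hz
    obtain ⟨θ, hθ, rfl⟩ := hz
    have hθ := Ioc_subset_Icc_self hθ
    refine (hle θ).trans (EReal.coe_le_coe_iff.2 ?_)
    change φ θ ≤ (F (circleMap c r θ)).re
    rw [hFv]
    have h1 := abs_lt.1 (happ θ hθ)
    linarith [hφψ θ hθ]
  · have hmean : (2 * Real.pi)⁻¹ * ∫ θ in (0:ℝ)..(2 * Real.pi), (F (circleMap c r θ)).re
        = (F c).re := by
      have := InnerProductSpace.HarmonicOnNhd.circleAverage_eq (f := fun z => (F z).re) (c := c)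
        (R := r) fun z _ => harmonicAt_re_of_differentiable hFd z
      rwa [Real.circleAverage_def, smul_eq_mul] at this
    have hFc : Continuous fun θ : ℝ => (F (circleMap c r θ)).re :=
      Complex.continuous_re.comp (hFd.continuous.comp (continuous_circleMap c r))
    have hmono : ∫ θ in (0:ℝ)..(2 * Real.pi), (F (circleMap c r θ)).re ≤
        ∫ θ in (0:ℝ)..(2 * Real.pi), (ψ θ + ε / 2) := by
      refine intervalIntegral.integral_mono_on hpi.le (hFc.intervalIntegrable _ _)
        ((hψ.add continuous_const).intervalIntegrable _ _) fun θ hθ => ?_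
      rw [hFv]
      have h1 := abs_lt.1 (happ θ hθ)
      linarith
    rw [intervalIntegral.integral_add (hψ.intervalIntegrable _ _) (by simp),
      intervalIntegral.integral_const, smul_eq_mul, sub_zero] at hmono
    have h2 := mul_le_mul_of_nonneg_left hmono (inv_nonneg.2 hpi.le)
    rw [hmean, mul_add, inv_mul_cancel_left₀ hpi.ne'] at h2
    linarith

/-- Riemann sums of `x ↦ log |ρ - x|` with the singularity cut off at the mesh size are bounded
below, uniformly in the mesh size. -/
theorem exists_le_sum_log (a L R : ℝ) (hL : 0 < L) :
    ∃ C : ℝ, ∀ N : ℕ, 0 < N → ∀ ρ ∈ Icc 0 R, ∀ d : ℕ → ℝ, (∀ k < N, L / N ≤ d k) →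
      (∀ k < N, |ρ - (a + k * (L / N))| ≤ d k) →
      C ≤ ∑ k ∈ Finset.range N, L / N * Real.log (d k) := by
  have hcont : Continuous fun ρ : ℝ =>
      (ρ - a) * Real.log (ρ - a) - (ρ - (a + L)) * Real.log (ρ - (a + L)) - (ρ - a) +
        (ρ - (a + L)) - L * Real.log 2 := by
    have h1 := Real.continuous_mul_log.comp (continuous_id.sub (continuous_const (y := a)))
    have h2 := Real.continuous_mul_log.comp (continuous_id.sub (continuous_const (y := a + L)))
    exact (((h1.sub h2).sub (by fun_prop)).add (by fun_prop)).sub (by fun_prop)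
  obtain ⟨C, hC⟩ := (isCompact_Icc (a := 0) (b := R)).bddBelow_image hcont.continuousOn
  refine ⟨C, fun N hN ρ hρ d hd hρd => (hC ⟨ρ, hρ, rfl⟩).trans ?_⟩
  have hN' : (0 : ℝ) < N := by exact_mod_cast hN
  set δ := L / N with hδ
  have hδ0 : 0 < δ := by positivity
  set x : ℕ → ℝ := fun k => a + k * δ with hx
  have hlogI : ∀ s t : ℝ, IntervalIntegrable (fun y => Real.log (ρ - y)) volume s t := by
    intro s t
    have := (intervalIntegral.intervalIntegrable_log' (a := ρ - s) (b := ρ - t)).comp_sub_left ρ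
    simpa using this
  have hpiece : ∀ k < N, ∫ y in x k..x (k + 1), (Real.log (ρ - y) - Real.log 2) ≤
      δ * Real.log (d k) := by
    intro k hk
    have hxk : x k ≤ x (k + 1) := by simp [hx]; nlinarith
    have hc : ∫ _ in x k..x (k + 1), Real.log (d k) = δ * Real.log (d k) := by
      have : x (k + 1) - x k = δ := by simp [hx]; ring
      rw [intervalIntegral.integral_const, smul_eq_mul, this]
    rw [← hc]
    refine intervalIntegral.integral_mono_ae_restrict hxk ((hlogI _ _).sub (by simp)) (by simp) ?_
    have hne : ∀ᵐ y ∂volume.restrict (Icc (x k) (x (k + 1))), y ≠ ρ :=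
      ae_restrict_of_ae (by simp [ae_iff, measure_singleton])
    filter_upwards [hne, ae_restrict_mem measurableSet_Icc] with y hy hyk
    have h1 := hd k hk
    have h2 := hρd k hk
    have hdk : 0 < d k := hδ0.trans_le h1
    have hxk1 : x (k + 1) = x k + δ := by simp [hx]; ring
    rw [sub_le_iff_le_add, ← Real.log_mul hdk.ne' two_ne_zero, ← Real.log_abs]
    refine Real.log_le_log (abs_pos.2 (sub_ne_zero.2 hy.symm)) ?_
    have h3 : |ρ - x k| ≤ d k := h2
    rw [abs_le] at h3 ⊢
    rw [hxk1] at hyk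
    constructor <;> linarith [hyk.1, hyk.2]
  refine le_trans (le_of_eq ?_) (Finset.sum_le_sum fun k hk => hpiece k (Finset.mem_range.1 hk))
  rw [intervalIntegral.sum_integral_adjacent_intervals fun k _ => (hlogI _ _).sub (by simp),
    intervalIntegral.integral_sub (hlogI _ _) (by simp),
    intervalIntegral.integral_comp_sub_left (fun y => Real.log y), integral_log,
    intervalIntegral.integral_const]
  have h0 : x 0 = a := by simp [hx]
  have hNN : x N = a + L := by simp [hx, hδ]; field_simp
  rw [h0, hNN, smul_eq_mul]
  ring

theorem harmonicAt_sum_log_norm_sub {ι : Type*} (S : Finset ι) (c : ℝ) (s : ι → ℂ) {z : ℂ}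
    (hz : ∀ k ∈ S, z ≠ s k) :
    HarmonicAt (fun w => ∑ k ∈ S, c * Real.log ‖w - s k‖) z := by
  classical
  induction S using Finset.induction_on with
  | empty => simp
  | insert i S hi ih =>
    simp only [Finset.sum_insert hi]
    refine HarmonicAt.add ?_ (ih fun k hk => hz k (Finset.mem_insert_of_mem hk))
    have : HarmonicAt (fun w => Real.log ‖w - s i‖) z :=
      AnalyticAt.harmonicAt_log_norm (by fun_prop)
        (sub_ne_zero.2 (hz i (Finset.mem_insert_self _ _)))
    exact this.const_smul (c := c)

theorem UpperSemicontinuousOn.isOpen_setOf_lt {u : ℂ → EReal} {Ω : Set ℂ} (hΩ : IsOpen Ω)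
    (hu : UpperSemicontinuousOn u Ω) (y : EReal) : IsOpen {w | w ∈ Ω ∧ u w < y} := by
  refine isOpen_iff_mem_nhds.2 fun w hw => ?_
  have := hu w hw.1 y hw.2
  rw [hΩ.nhdsWithin_eq hw.1] at this
  filter_upwards [hΩ.mem_nhds hw.1, this] with v h1 h2 using ⟨h1, h2⟩

/-- A compact subset of the `-∞` set of a subharmonic function misses arbitrarily small circles
around any given point. -/
theorem SubharmonicOn.exists_sphere_disjoint {u : ℂ → EReal} {Ω : Set ℂ} (hu : SubharmonicOn u Ω)
    {K : Set ℂ} (hK : IsCompact K) (hKbot : ∀ z ∈ K, u z = ⊥) {z₀ : ℂ} {b : ℝ} (hb : 0 < b)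
    (hball : closedBall z₀ (4 * b) ⊆ Ω) : ∃ r ∈ Ioo 0 b, Disjoint (sphere z₀ r) K := by
  by_contra! hcon
  have hcon' : ∀ r ∈ Ioo 0 b, ∃ s ∈ K, dist s z₀ = r := by
    intro r hr
    obtain ⟨s, hs, hsK⟩ := Set.not_disjoint_iff.1 (hcon r hr)
    exact ⟨s, hsK, hs⟩
  choose! s hsK hsd using hcon'
  have hz₀ : z₀ ∈ Ω := hball (mem_closedBall_self (by positivity))
  obtain ⟨w, hwb, -, hw⟩ := hu.exists_ne_bot hz₀ (ball_mem_nhds z₀ hb)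
  refine hw (EReal.eq_bot_iff_forall_lt _ |>.2 fun y => ?_)
  obtain ⟨hΩ, husc, htop, -, hsub⟩ := hu
  obtain ⟨C', hC'⟩ := UpperSemicontinuousOn.exists_forall_le_coe (husc.mono hball)
    (isCompact_closedBall z₀ (4 * b)) fun w hw => htop w (hball hw)
  set C := max 0 C' with hCdef
  have hC0 : 0 ≤ C := le_max_left _ _
  have hC : ∀ z ∈ closedBall z₀ (4 * b), u z ≤ C :=
    fun z hz => (hC' z hz).trans (EReal.coe_le_coe_iff.2 (le_max_right _ _))
  obtain ⟨C₁, hC₁⟩ := exists_le_sum_log (b / 3) (b / 3) (4 * b) (by positivity)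
  set L := b / 3 with hL
  have hL0 : 0 < L := by positivity
  set C₂ := max 1 (L * Real.log (3 * b) - C₁) with hC₂def
  have hC₂ : 0 < C₂ := zero_lt_one.trans_le (le_max_left _ _)
  set κ := L * (Real.log (3 * b) - Real.log (2 * b)) with hκdef
  have hκ : 0 < κ := mul_pos hL0 (sub_pos.2 (Real.log_lt_log (by positivity) (by linarith)))
  obtain ⟨n, hn0, hny, hnκ⟩ : ∃ n : ℝ, 0 ≤ n ∧ -n < y ∧ C - n / C₂ * κ < y := by
    have h1 : Tendsto (fun n : ℝ => n / C₂ * κ) atTop atTop :=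
      (tendsto_id.atTop_div_const hC₂).atTop_mul_const hκ
    obtain ⟨n, ⟨h2, h3⟩, h4⟩ := ((eventually_ge_atTop (0 : ℝ)).and (eventually_gt_atTop (-y))
      |>.and (h1.eventually_gt_atTop (C - y))).exists
    exact ⟨n, h2, by linarith, by linarith⟩
  obtain ⟨η', hη', hthick⟩ := (hK.inter_right (isClosed_closedBall (x := z₀) (ε := b)))
    |>.exists_thickening_subset_open
    (UpperSemicontinuousOn.isOpen_setOf_lt hΩ husc ((-n : ℝ) : EReal)) (by
      rintro x ⟨hx, hxb⟩
      exact ⟨hball (closedBall_subset_closedBall (by linarith) hxb),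
        by simp [hKbot x hx, -EReal.coe_neg]⟩)
  set η := η' / 2 with hη
  have hη0 : 0 < η := by positivity
  obtain ⟨N, hN⟩ := exists_nat_gt (L / η)
  have hN0 : (0 : ℝ) < N := lt_trans (by positivity) hN
  have hNη : L / N ≤ η := by
    rw [div_lt_iff₀ hη0] at hN
    rw [div_le_iff₀ hN0]
    linarith
  set p : ℕ → ℂ := fun k => s (L + k * (L / N)) with hp
  have hmem : ∀ k < N, L + k * (L / N) ∈ Ioo 0 b ∧ L + k * (L / N) ≤ 2 * L := by
    intro k hk
    have : (k : ℝ) * (L / N) ≤ L := by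
      have hk' : (k : ℝ) ≤ N := by exact_mod_cast hk.le
      calc (k : ℝ) * (L / N) ≤ N * (L / N) := by gcongr
        _ = L := by field_simp
    refine ⟨⟨by positivity, ?_⟩, ?_⟩ <;> linarith
  have hpd : ∀ k < N, dist (p k) z₀ = L + k * (L / N) := fun k hk => hsd _ (hmem k hk).1
  have hpu : ∀ k < N, ∀ z, dist z (p k) ≤ η → u z < ((-n : ℝ) : EReal) := by
    intro k hk z hz
    refine (hthick (mem_thickening_iff.2 ⟨p k, ⟨hsK _ (hmem k hk).1, ?_⟩, by linarith⟩)).2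
    rw [mem_closedBall, hpd k hk]
    exact (hmem k hk).1.2.le
  set h : ℂ → ℝ := fun z => L * Real.log (3 * b) - ∑ k ∈ Finset.range N, L / N * Real.log ‖z - p k‖
    with hh
  have hNL : ∀ y : ℝ, ∑ k ∈ Finset.range N, L / N * y = L * y := by
    intro y
    rw [Finset.sum_const, Finset.card_range, nsmul_eq_mul]
    field_simp
  set t := (n + C) / C₂ with ht
  have ht0 : 0 ≤ t := by positivity
  set X : Set ℂ := closedBall z₀ (4 * b) ∩ ⋂ k ∈ Finset.range N, (ball (p k) η)ᶜ with hX
  have hXη : ∀ z ∈ X, ∀ k < N, η ≤ dist z (p k) := by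
    intro z hz k hk
    have := mem_iInter₂.1 hz.2 k (Finset.mem_range.2 hk)
    simpa using this
  have hXc : IsCompact X := (isCompact_closedBall _ _).inter_right
    (isClosed_biInter fun k _ => isOpen_ball.isClosed_compl)
  have hXΩ : X ⊆ Ω := inter_subset_left.trans hball
  have hharm : ∀ z ∈ X, HarmonicAt h z := fun z hz =>
    (harmonicAt_const _).sub (harmonicAt_sum_log_norm_sub _ _ _ fun k hk => by
      have := hXη z hz k (Finset.mem_range.1 hk)
      exact dist_pos.1 (hη0.trans_le this))
  have hhC₂ : ∀ z ∈ X, h z ≤ C₂ := by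
    intro z hz
    refine le_trans ?_ (le_max_right _ _)
    refine sub_le_sub_left (hC₁ N (by exact_mod_cast hN0) (dist z z₀) ⟨dist_nonneg, hz.1⟩
      (fun k => ‖z - p k‖) (fun k hk => ?_) fun k hk => ?_) _
    · rw [← dist_eq_norm]
      exact hNη.trans (hXη z hz k hk)
    · rw [← hpd k hk, ← dist_eq_norm]
      exact abs_dist_sub_le _ _ _
  have hMP : ∀ z ∈ X, u z + ((t * h z : ℝ) : EReal) ≤ C := by
    have hcont : ContinuousOn (fun z => t * h z) X := fun z hz =>
      (continuousAt_const.mul (hharm z hz).1.continuousAt).continuousWithinAt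
    refine le_of_circleSubmean hXc ((husc.mono hXΩ).add_coe hcont) (fun z hz => ?_)
      fun z hz hCz => ?_
    · exact (EReal.add_lt_top (htop z (hXΩ hz)) (EReal.coe_ne_top _)).ne
    have hz1 : dist z z₀ < 4 * b := by
      refine lt_of_le_of_ne hz.1 fun he => hCz.not_ge ?_
      have : h z ≤ 0 := by
        rw [hh, sub_nonpos, ← hNL]
        refine Finset.sum_le_sum fun k hk => ?_
        gcongr
        have h1 := hpd k (Finset.mem_range.1 hk)
        have h2 := (hmem k (Finset.mem_range.1 hk)).2
        have h3 := dist_triangle z (p k) z₀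
        rw [← dist_eq_norm]
        linarith
      calc u z + ((t * h z : ℝ) : EReal) ≤ C + (0 : ℝ) := by
            refine add_le_add (hC z hz.1) (EReal.coe_le_coe_iff.2 ?_)
            exact mul_nonpos_of_nonneg_of_nonpos ht0 this
        _ = C := by simp
    have hz2 : ∀ k ∈ Finset.range N, η < dist z (p k) := by
      intro k hk
      refine lt_of_le_of_ne (hXη z hz k (Finset.mem_range.1 hk)) fun he => hCz.not_ge ?_
      calc u z + ((t * h z : ℝ) : EReal) ≤ ((-n : ℝ) : EReal) + ((t * C₂ : ℝ) : EReal) := by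
            refine add_le_add (hpu k (Finset.mem_range.1 hk) z he.ge).le
              (EReal.coe_le_coe_iff.2 ?_)
            exact mul_le_mul_of_nonneg_left (hhC₂ z hz) ht0
        _ = C := by
            rw [← EReal.coe_add, ht, div_mul_cancel₀ _ hC₂.ne']
            ring_nf
    have hnhds : X ∈ 𝓝 z := by
      have h1 : ∀ᶠ w in 𝓝 z, ∀ k ∈ Finset.range N, η < dist w (p k) :=
        (Filter.eventually_all_finset _).2 fun k hk =>
          (Continuous.dist continuous_id continuous_const).continuousAt.eventually_const_lt
            (hz2 k hk)
      filter_upwards [h1, isOpen_ball.mem_nhds (mem_ball.2 hz1)] with w hw hwb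
      exact ⟨ball_subset_closedBall hwb, mem_iInter₂.2 fun k hk => by simpa using (hw k hk).le⟩
    obtain ⟨r, hr, hrX⟩ := Metric.nhds_basis_closedBall.mem_iff.1 hnhds
    refine ⟨r, hr, hrX, (hsub.circleSubmean hr (hrX.trans hXΩ)).add_harmonic hr fun x hx => ?_⟩
    exact (hharm x (hrX hx)).const_smul (c := t)
  by_cases hwX : w ∈ X
  · have h1 := hMP w hwX
    have h2 : κ ≤ h w := by
      rw [hκdef, mul_sub]
      refine sub_le_sub_left ?_ _
      rw [← hNL]
      refine Finset.sum_le_sum fun k hk => ?_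
      have h3 := hXη w hwX k (Finset.mem_range.1 hk)
      have h4 := hpd k (Finset.mem_range.1 hk)
      have h5 := (hmem k (Finset.mem_range.1 hk)).2
      have h6 := dist_triangle_right w (p k) z₀
      have h7 : dist w z₀ < b := hwb
      rw [← dist_eq_norm]
      gcongr
      · linarith
      · linarith
    have h8 : n / C₂ * κ ≤ t * h w := by
      refine mul_le_mul ?_ h2 hκ.le ht0
      rw [ht]
      gcongr
      linarith
    have h9 : u w ≤ ((C - t * h w : ℝ) : EReal) := by
      rw [EReal.coe_sub]
      exact EReal.le_sub_iff_add_le (by simp) (by simp) |>.2 h1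
    exact h9.trans_lt (EReal.coe_lt_coe_iff.2 (by linarith))
  · have : ∃ k < N, dist w (p k) < η := by
      by_contra! hno
      refine hwX ⟨ball_subset_closedBall (ball_subset_ball (by linarith) hwb), ?_⟩
      exact mem_iInter₂.2 fun k hk => by simpa using hno k (Finset.mem_range.1 hk)
    obtain ⟨k, hk, hkη⟩ := this
    exact (hpu k hk w hkη.le).trans (EReal.coe_lt_coe_iff.2 hny)

theorem CircleSubmean.congr {u v : ℂ → EReal} {c : ℂ} {r : ℝ} (hu : CircleSubmean u c r)
    (hr : 0 < r) (huv : EqOn u v (closedBall c r)) : CircleSubmean v c r := by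
  intro φ hφ hle
  rw [← huv (mem_closedBall_self hr.le)]
  refine hu φ hφ fun θ => ?_
  rw [huv (circleMap_mem_closedBall c hr.le θ)]
  exact hle θ

theorem circleSubmean_of_harmonic {u : ℂ → EReal} {c : ℂ} {r : ℝ} (hr : 0 < r)
    (H : ∀ h : ℂ → ℝ, (∀ z, HarmonicAt h z) → (∀ z ∈ sphere c r, u z ≤ h z) → u c ≤ h c) :
    CircleSubmean u c r := by
  intro φ hφ hle
  by_contra! hlt
  obtain ⟨y, hy, hyu⟩ := EReal.lt_iff_exists_real_btwn.1 hlt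
  obtain ⟨h, hh, hs, hc⟩ := exists_harmonic_majorant hr hφ hle
    (sub_pos.2 (EReal.coe_lt_coe_iff.1 hy))
  refine hyu.not_ge ((H h hh hs).trans (EReal.coe_le_coe_iff.2 ?_))
  linarith

/-- For upper semicontinuous functions, the sub-mean value inequality is a local property. -/
theorem submeanOn_of_locally {u : ℂ → EReal} {Ω : Set ℂ} (hu : UpperSemicontinuousOn u Ω)
    (htop : ∀ z ∈ Ω, u z ≠ ⊤)
    (hloc : ∀ z ∈ Ω, ∃ R > 0, ∀ r ∈ Ioc 0 R, CircleSubmean u z r) : SubmeanOn u Ω := by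
  intro c r hr hc
  refine circleSubmean_of_harmonic hr fun h hh hs => ?_
  have hle : ∀ x ∈ closedBall c r, u x + ((-h x : ℝ) : EReal) ≤ (0 : ℝ) := by
    refine le_of_circleSubmean (isCompact_closedBall c r) ((hu.mono hc).add_coe fun x _ =>
      (hh x).1.continuousAt.neg.continuousWithinAt) (fun x hx =>
      (EReal.add_lt_top (htop x (hc hx)) (EReal.coe_ne_top _)).ne) fun x hx hpos => ?_
    have hx' : x ∈ ball c r := by
      refine mem_ball.2 (lt_of_le_of_ne (mem_closedBall.1 hx) fun he => hpos.not_ge ?_)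
      calc u x + ((-h x : ℝ) : EReal) ≤ (h x : EReal) + ((-h x : ℝ) : EReal) :=
            add_le_add_left (hs x he) _
        _ = (0 : ℝ) := by rw [← EReal.coe_add, add_neg_cancel]
    obtain ⟨R, hR, hRu⟩ := hloc x (hc hx)
    obtain ⟨s, hs, hsb⟩ := Metric.nhds_basis_closedBall.mem_iff.1 (isOpen_ball.mem_nhds hx')
    have hm : 0 < min s R := lt_min hs hR
    refine ⟨min s R, hm, (closedBall_subset_closedBall (min_le_left _ _)).trans
      (hsb.trans ball_subset_closedBall), (hRu _ ⟨hm, min_le_right _ _⟩).add_harmonic hm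
      fun y _ => (hh y).neg⟩
  have := hle c (mem_closedBall_self hr.le)
  rw [EReal.coe_neg, ← sub_eq_add_neg] at this
  simpa using EReal.sub_nonpos.1 this

/-- Subharmonicity is a local property. -/
theorem SubharmonicOn.of_locally_eq {u : ℂ → EReal} {Ω : Set ℂ} (hΩ : IsOpen Ω)
    (hloc : ∀ z ∈ Ω, ∃ (v : ℂ → EReal) (V W : Set ℂ), IsOpen V ∧ z ∈ V ∧ V ⊆ W ∧
      SubharmonicOn v W ∧ EqOn v u V) : SubharmonicOn u Ω := by
  have husc : UpperSemicontinuousOn u Ω := by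
    intro z hz y hy
    obtain ⟨v, V, W, hV, hzV, hVW, hv, huv⟩ := hloc z hz
    rw [← huv hzV] at hy
    have := hv.2.1 z (hVW hzV) y hy
    rw [hv.1.nhdsWithin_eq (hVW hzV)] at this
    refine mem_nhdsWithin_of_mem_nhds ?_
    filter_upwards [this, hV.mem_nhds hzV] with x hx hxV
    rwa [← huv hxV]
  have htop : ∀ z ∈ Ω, u z ≠ ⊤ := by
    intro z hz
    obtain ⟨v, V, W, hV, hzV, hVW, hv, huv⟩ := hloc z hz
    rw [← huv hzV]
    exact hv.2.2.1 z (hVW hzV)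
  refine ⟨hΩ, husc, htop, fun z hz => ?_, submeanOn_of_locally husc htop fun z hz => ?_⟩ <;>
    obtain ⟨v, V, W, hV, hzV, hVW, hv, huv⟩ := hloc z hz
  · obtain ⟨r, hr, hrΩ⟩ := Metric.mem_nhds_iff.1 ((hΩ.inter hV).mem_nhds ⟨hz, hzV⟩)
    obtain ⟨w, hw, -, hwb⟩ := hv.exists_ne_bot (hVW hzV) (ball_mem_nhds z hr)
    refine ⟨w, (convex_ball z r).isPreconnected.subset_connectedComponentIn (mem_ball_self hr)
      (hrΩ.trans inter_subset_left) hw, ?_⟩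
    rwa [← huv (hrΩ hw).2]
  · obtain ⟨R, hR, hRV⟩ := Metric.nhds_basis_closedBall.mem_iff.1 (hV.mem_nhds hzV)
    refine ⟨R, hR, fun r hr => ?_⟩
    have hrV := (closedBall_subset_closedBall hr.2).trans hRV
    exact (hv.2.2.2.2.circleSubmean hr.1 (hrV.trans hVW)).congr hr.1 (huv.mono hrV)

theorem SubharmonicOn.subset_closure_of_eq_bot {v : ℂ → EReal} {Ω W D : Set ℂ}
    (hv : SubharmonicOn v Ω) (hW : IsOpen W) (hWΩ : W ⊆ Ω) (hbot : ∀ w ∈ W \ D, v w = ⊥) :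
    W ⊆ closure D := by
  intro z hz
  refine mem_closure_iff_nhds.2 fun U hU => ?_
  obtain ⟨w, hw, -, hwb⟩ := hv.exists_ne_bot (hWΩ hz) (inter_mem hU (hW.mem_nhds hz))
  exact ⟨w, hw.1, by_contra fun hwD => hwb (hbot w ⟨hw.2, hwD⟩)⟩

theorem exists_nhd_subset_DHat {D : Set ℂ} (hD : IsOpen D) {ρ : ℂ → EReal} {z : ℂ}
    (hz : z ∈ DHat D ρ \ D) :
    ∃ (v : ℂ → EReal) (W Ω : Set ℂ), IsOpen W ∧ z ∈ W ∧ W ⊆ Ω ∧ W ⊆ DHat D ρ ∧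
      SubharmonicOn v Ω ∧ ∀ w ∈ W \ D, v w = ⊥ := by
  obtain ⟨hzD | ⟨⟨hzf, U, hU, hzU, Ω, hUΩ, v, hv, hvb⟩, hlim⟩, hzD'⟩ := hz
  · exact absurd hzD hzD'
  obtain ⟨c, hc, hcT⟩ := exists_between hlim
  have hev := eventually_lt_of_limsup_lt hc
  obtain ⟨V, hV, hzV, hVρ⟩ := mem_nhdsWithin.1 hev
  have hUΩo : IsOpen (U ∩ Ω) := hU.inter hv.1
  have hbot : ∀ w ∈ (U ∩ Ω) \ D, v w = ⊥ := fun w hw => hvb w ⟨hw.1.1, hw.2⟩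
  refine ⟨v, U ∩ Ω ∩ V, Ω, hUΩo.inter hV, ⟨⟨hzU, hUΩ ⟨hzU, hzD'⟩⟩, hzV⟩,
    fun w hw => hw.1.2, fun w hw => ?_, hv, fun w hw => hbot w ⟨hw.1.1, hw.2⟩⟩
  by_cases hwD : w ∈ D
  · exact Or.inl hwD
  refine Or.inr ⟨⟨?_, U ∩ Ω, hUΩo, hw.1, Ω, fun x hx => hx.1.2, v, hv, hbot⟩, ?_⟩
  · rw [hD.frontier_eq]
    exact ⟨hv.subset_closure_of_eq_bot hUΩo inter_subset_right hbot hw.1, hwD⟩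
  · refine (limsup_le_of_le (by isBoundedDefault) ?_).trans_lt hcT
    filter_upwards [mem_nhdsWithin_of_mem_nhds (hV.mem_nhds hw.2),
      self_mem_nhdsWithin] with x hx hxD
    exact (hVρ ⟨hx, hxD⟩ : ρ x < c).le

theorem isOpen_DHat {D : Set ℂ} (hD : IsOpen D) (ρ : ℂ → EReal) : IsOpen (DHat D ρ) := by
  refine isOpen_iff_mem_nhds.2 fun z hz => ?_
  by_cases hzD : z ∈ D
  · exact mem_of_superset (hD.mem_nhds hzD) subset_union_left
  · obtain ⟨-, W, -, hW, hzW, -, hWG, -⟩ := exists_nhd_subset_DHat hD ⟨hz, hzD⟩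
    exact mem_of_superset (hW.mem_nhds hzW) hWG

theorem DHat_subset (D : Set ℂ) (ρ : ℂ → EReal) : DHat D ρ ⊆ D ∪ polarS D :=
  union_subset_union_right _ fun _ h => h.1

theorem isConnected_DHat {D : Set ℂ} (hD : IsConnected D) (ρ : ℂ → EReal) :
    IsConnected (DHat D ρ) :=
  hD.subset_closure subset_union_left <| (DHat_subset D ρ).trans <|
    union_subset subset_closure fun _ h => frontier_subset_closure h.1

theorem rhoHat_of_mem {D : Set ℂ} {ρ : ℂ → EReal} {z : ℂ} (hz : z ∈ D) : rhoHat D ρ z = ρ z :=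
  if_pos hz

theorem rhoHat_of_notMem {D : Set ℂ} {ρ : ℂ → EReal} {z : ℂ} (hz : z ∉ D) :
    rhoHat D ρ z = limsup ρ (𝓝[D] z) :=
  if_neg hz

theorem rhoHat_ne_top {D : Set ℂ} {ρ : ℂ → EReal} (hρ : SubharmonicOn ρ D) {z : ℂ}
    (hz : z ∈ DHat D ρ) : rhoHat D ρ z ≠ ⊤ := by
  by_cases hzD : z ∈ D
  · rw [rhoHat_of_mem hzD]
    exact hρ.2.2.1 z hzD
  · rw [rhoHat_of_notMem hzD]
    exact (hz.resolve_left hzD).2.ne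

theorem upperSemicontinuous_rhoHat {D : Set ℂ} {ρ : ℂ → EReal} (hρ : SubharmonicOn ρ D) :
    UpperSemicontinuous (rhoHat D ρ) := by
  intro z y hy
  by_cases hzD : z ∈ D
  · rw [rhoHat_of_mem hzD] at hy
    have := hρ.2.1 z hzD y hy
    rw [hρ.1.nhdsWithin_eq hzD] at this
    filter_upwards [this, hρ.1.mem_nhds hzD] with w hw hwD
    rwa [rhoHat_of_mem hwD]
  · rw [rhoHat_of_notMem hzD] at hy
    obtain ⟨c, hc, hcy⟩ := exists_between hy
    obtain ⟨V, hV, hzV, hVρ⟩ := mem_nhdsWithin.1 (eventually_lt_of_limsup_lt hc)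
    filter_upwards [hV.mem_nhds hzV] with w hw
    refine lt_of_le_of_lt ?_ hcy
    by_cases hwD : w ∈ D
    · rw [rhoHat_of_mem hwD]
      exact (hVρ ⟨hw, hwD⟩ : ρ w < c).le
    · rw [rhoHat_of_notMem hwD]
      refine limsup_le_of_le (by isBoundedDefault) ?_
      filter_upwards [mem_nhdsWithin_of_mem_nhds (hV.mem_nhds hw),
        self_mem_nhdsWithin] with x hx hxD
      exact (hVρ ⟨hx, hxD⟩ : ρ x < c).le

theorem polarSet_DHat_diff {D : Set ℂ} (hD : IsOpen D) (ρ : ℂ → EReal) :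
    PolarSet (DHat D ρ \ D) := by
  have key : ∀ z ∈ DHat D ρ \ D, ∃ (v : ℂ → EReal) (Ω : Set ℂ) (r : ℝ), 0 < r ∧ ball z r ⊆ Ω ∧
      SubharmonicOn v Ω ∧ (∀ w ∈ ball z r \ D, v w = ⊥) ∧ sphere z r ⊆ D := by
    intro z hz
    obtain ⟨v, W, Ω, hW, hzW, hWΩ, -, hv, hbot⟩ := exists_nhd_subset_DHat hD hz
    obtain ⟨R, hR, hRW⟩ := Metric.nhds_basis_closedBall.mem_iff.1 (hW.mem_nhds hzW)
    have hb : 0 < R / 4 := by positivity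
    have hbW : closedBall z (R / 4) ⊆ W :=
      (closedBall_subset_closedBall (by linarith)).trans hRW
    obtain ⟨r, hr, hdisj⟩ := hv.exists_sphere_disjoint
      (K := closedBall z (R / 4) \ D) ((isCompact_closedBall _ _).diff hD)
      (fun w hw => hbot w ⟨hbW hw.1, hw.2⟩) hb (by
        rw [mul_div_cancel₀ _ (by norm_num)]
        exact hRW.trans hWΩ)
    have hrb : closedBall z r ⊆ closedBall z (R / 4) := closedBall_subset_closedBall hr.2.le
    refine ⟨v, Ω, r, hr.1, ?_, hv, fun w hw => hbot w ⟨?_, hw.2⟩, fun w hw => ?_⟩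
    · exact ball_subset_closedBall.trans (hrb.trans (hbW.trans hWΩ))
    · exact hbW (hrb (ball_subset_closedBall hw.1))
    · by_contra hwD
      exact Set.disjoint_left.1 hdisj hw ⟨hrb (sphere_subset_closedBall hw), hwD⟩
  choose! v Ω r hr hrΩ hv hbot hsph using key
  rcases (DHat D ρ \ D).eq_empty_or_nonempty with he | hne
  · rw [he]
    exact ⟨∅, Subset.rfl, fun _ => 0, SubharmonicOn.of_locally_eq isOpen_empty (by simp), by simp⟩
  obtain ⟨t, htE, htc, hcov⟩ := TopologicalSpace.countable_cover_nhdsWithin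
    (s := DHat D ρ \ D) (f := fun z => ball z (r z))
    fun z hz => mem_nhdsWithin_of_mem_nhds (ball_mem_nhds z (hr z hz))
  have htne : t.Nonempty := by
    obtain ⟨z, hz⟩ := hne
    obtain ⟨x, hx, -⟩ := mem_iUnion₂.1 (hcov hz)
    exact ⟨x, hx⟩
  obtain ⟨f, rfl⟩ := htc.exists_eq_range htne
  have hfE : ∀ n, f n ∈ DHat D ρ \ D := fun n => htE (mem_range_self n)
  set V : ℕ → Set ℂ := fun n => ball (f n) (r (f n)) ∩ ⋂ j ∈ Finset.range n,
    (closedBall (f j) (r (f j)))ᶜ with hVdef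
  have hVo : ∀ n, IsOpen (V n) := fun n => isOpen_ball.inter
    (isOpen_biInter_finset fun j _ => isClosed_closedBall.isOpen_compl)
  have hlt : ∀ n m x, x ∈ V n → x ∈ V m → ¬ n < m := fun n m x hn hm h =>
    mem_iInter₂.1 hm.2 n (Finset.mem_range.2 h) (ball_subset_closedBall hn.1)
  have huniq : ∀ n m x, x ∈ V n → x ∈ V m → n = m := fun n m x hn hm =>
    le_antisymm (not_lt.1 (hlt m n x hm hn)) (not_lt.1 (hlt n m x hn hm))
  classical
  let u : ℂ → EReal := fun x => if h : ∃ n, x ∈ V n then v (f (Nat.find h)) x else 0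
  have hu : ∀ n, EqOn (v (f n)) u (V n) := by
    intro n x hx
    have h : ∃ n, x ∈ V n := ⟨n, hx⟩
    simp only [u, dif_pos h]
    rw [huniq _ _ x (Nat.find_spec h) hx]
  have hEV : ∀ x ∈ DHat D ρ \ D, ∃ n, x ∈ V n := by
    intro x hx
    have h : ∃ n, x ∈ ball (f n) (r (f n)) := by simpa using hcov hx
    refine ⟨Nat.find h, Nat.find_spec h, mem_iInter₂.2 fun j hj hxj => ?_⟩
    refine Nat.find_min h (Finset.mem_range.1 hj) (mem_ball.2
      (lt_of_le_of_ne (mem_closedBall.1 hxj) fun he => hx.2 ?_))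
    exact hsph _ (hfE j) he
  refine ⟨⋃ n, V n, fun x hx => mem_iUnion.2 (hEV x hx), u,
    SubharmonicOn.of_locally_eq (isOpen_iUnion hVo) fun z hz => ?_, fun x hx => ?_⟩
  · obtain ⟨n, hn⟩ := mem_iUnion.1 hz
    exact ⟨v (f n), V n, Ω (f n), hVo n, hn, inter_subset_left.trans (hrΩ _ (hfE n)),
      hv _ (hfE n), hu n⟩
  · obtain ⟨n, hn⟩ := hEV x hx
    rw [← hu n hn]
    exact hbot _ (hfE n) x ⟨hn.1, hx.2⟩

theorem rhoHat_le_harmonic {D : Set ℂ} {ρ : ℂ → EReal} (hρ : SubharmonicOn ρ D) {v : ℂ → EReal}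
    {Ω : Set ℂ} (hv : SubharmonicOn v Ω) {z : ℂ} {r : ℝ} (hr : 0 < r) (hzD : z ∉ D)
    (hΩ : closedBall z r ⊆ Ω) (hG : closedBall z r ⊆ DHat D ρ)
    (hbot : ∀ w ∈ closedBall z r \ D, v w = ⊥) {h : ℂ → ℝ} (hh : ∀ w, HarmonicAt h w)
    (hs : ∀ w ∈ sphere z r, rhoHat D ρ w ≤ h w) : rhoHat D ρ z ≤ h z := by
  have husc := upperSemicontinuous_rhoHat hρ
  have hhc : Continuous h := continuous_iff_continuousAt.2 fun w => (hh w).1.continuousAt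
  have hsub : ∀ w s, 0 < s → closedBall w s ⊆ D → CircleSubmean (rhoHat D ρ) w s :=
    fun w s hs hw => (hρ.2.2.2.2.circleSubmean hs hw).congr hs
      fun x hx => (rhoHat_of_mem (hw hx)).symm
  obtain ⟨K, hK⟩ := UpperSemicontinuousOn.exists_forall_le_coe (hv.2.1.mono hΩ)
    (isCompact_closedBall z r) fun w hw => hv.2.2.1 w (hΩ hw)
  have hMP : ∀ δ : ℝ, 0 < δ → ∀ x ∈ closedBall z r,
      (rhoHat D ρ x + ((-h x - δ * K : ℝ) : EReal)) + (δ : EReal) * v x ≤ (0 : ℝ) := by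
    intro δ hδ
    have hc : Continuous fun x => -h x - δ * K := hhc.neg.sub continuous_const
    have hu1 : UpperSemicontinuousOn (fun x => rhoHat D ρ x + ((-h x - δ * K : ℝ) : EReal))
        (closedBall z r) := (husc.upperSemicontinuousOn _).add_coe hc.continuousOn
    have hu2 := (hv.2.1.mono hΩ).const_mul_ereal hδ
    have ht1 : ∀ x ∈ closedBall z r, rhoHat D ρ x + ((-h x - δ * K : ℝ) : EReal) ≠ ⊤ :=
      fun x hx => (EReal.add_lt_top (rhoHat_ne_top hρ (hG hx)) (EReal.coe_ne_top _)).ne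
    have hle2 : ∀ x ∈ closedBall z r, (δ : EReal) * v x ≤ ((δ * K : ℝ) : EReal) := by
      intro x hx
      rw [EReal.coe_mul]
      exact mul_le_mul_of_nonneg_left (hK x hx) (EReal.coe_nonneg.2 hδ.le)
    have ht2 : ∀ x ∈ closedBall z r, (δ : EReal) * v x ≠ ⊤ :=
      fun x hx => ((hle2 x hx).trans_lt (EReal.coe_lt_top _)).ne
    refine le_of_circleSubmean (isCompact_closedBall z r) (hu1.add_ereal hu2 ht1 ht2)
      (fun x hx => (EReal.add_lt_top (ht1 x hx) (ht2 x hx)).ne) fun x hx hpos => ?_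
    have hxb : x ∈ ball z r := by
      refine mem_ball.2 (lt_of_le_of_ne (mem_closedBall.1 hx) fun he => hpos.not_ge ?_)
      calc _ ≤ ((h x : EReal) + ((-h x - δ * K : ℝ) : EReal)) + ((δ * K : ℝ) : EReal) :=
            add_le_add (add_le_add (hs x he) le_rfl) (hle2 x hx)
        _ = (0 : ℝ) := by
            rw [← EReal.coe_add, ← EReal.coe_add]
            ring_nf
    have hxD : x ∈ D := by
      by_contra hxD
      rw [hbot x ⟨hx, hxD⟩, EReal.coe_mul_bot_of_pos hδ, EReal.add_bot] at hpos
      exact not_lt_bot hpos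
    obtain ⟨s, hs, hsb⟩ := Metric.nhds_basis_closedBall.mem_iff.1
      ((isOpen_ball.inter hρ.1).mem_nhds ⟨hxb, hxD⟩)
    have hsX : closedBall x s ⊆ closedBall z r :=
      (hsb.trans inter_subset_left).trans ball_subset_closedBall
    refine ⟨s, hs, hsX, CircleSubmean.add hs ?_ ?_ (hu1.mono hsX) (hu2.mono hsX)
      (fun y hy => ht1 y (hsX hy)) fun y hy => ht2 y (hsX hy)⟩
    · exact (hsub x s hs (hsb.trans inter_subset_right)).add_harmonic hs
        fun y _ => (hh y).neg.sub (harmonicAt_const _)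
    · exact (hv.2.2.2.2.circleSubmean hs (hsX.trans hΩ)).const_mul hδ
  have hne : ∀ x ∈ closedBall z r, v x ≠ ⊥ → rhoHat D ρ x ≤ h x := by
    intro x hx hvx
    by_contra! hlt
    obtain ⟨y, hy, hyσ⟩ := EReal.lt_iff_exists_real_btwn.1 hlt
    have hy := EReal.coe_lt_coe_iff.1 hy
    obtain ⟨m, hm⟩ : ∃ m : ℝ, v x = m := by
      lift v x to ℝ using ⟨hv.2.2.1 x (hΩ hx), hvx⟩ with m
      exact ⟨m, rfl⟩
    have hmK : 0 ≤ K - m := by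
      have := hK x hx
      rw [hm, EReal.coe_le_coe_iff] at this
      linarith
    set δ := (y - h x) / (K - m + 1) with hδ
    have hδ0 : 0 < δ := div_pos (by linarith) (by linarith)
    have h1 : δ * (K - m + 1) = y - h x := div_mul_cancel₀ _ (by linarith)
    have h2 := hMP δ hδ0 x hx
    rw [hm] at h2
    have h3 : (((y + (-h x - δ * K)) + δ * m : ℝ) : EReal) ≤ (0 : ℝ) := by
      refine le_trans ?_ h2
      rw [EReal.coe_add, EReal.coe_add, EReal.coe_mul]
      exact add_le_add (add_le_add hyσ.le le_rfl) le_rfl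
    rw [EReal.coe_le_coe_iff] at h3
    nlinarith
  have hDle : ∀ x ∈ ball z r ∩ D, rhoHat D ρ x ≤ h x := by
    intro x hx
    by_contra! hlt
    obtain ⟨y, hy, hyσ⟩ := EReal.lt_iff_exists_real_btwn.1 hlt
    have hy := EReal.coe_lt_coe_iff.1 hy
    obtain ⟨R, hR, hRb⟩ := Metric.nhds_basis_closedBall.mem_iff.1
      ((isOpen_ball.inter hρ.1).mem_nhds hx)
    have hRX : closedBall x R ⊆ closedBall z r :=
      (hRb.trans inter_subset_left).trans ball_subset_closedBall
    have hcu : UpperSemicontinuousOn (fun w => rhoHat D ρ w + ((-h w : ℝ) : EReal))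
        (closedBall x R) := (husc.upperSemicontinuousOn _).add_coe hhc.neg.continuousOn
    obtain ⟨s, hs, hdisj⟩ := hv.exists_sphere_disjoint (z₀ := x) (b := R / 4)
      (hcu.isCompact_inter_preimage_Ici (isCompact_closedBall x R) ((y - h x : ℝ) : EReal))
      (fun w hw => by
        by_contra hvw
        have h1 : ((y - h x : ℝ) : EReal) ≤ (h w : EReal) + ((-h w : ℝ) : EReal) :=
          le_trans hw.2 (add_le_add (hne w (hRX hw.1) hvw) le_rfl)
        rw [← EReal.coe_add, EReal.coe_le_coe_iff] at h1
        linarith) (by positivity) (by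
        rw [mul_div_cancel₀ _ (by norm_num)]
        exact hRX.trans hΩ)
    have hsR : closedBall x s ⊆ closedBall x R :=
      closedBall_subset_closedBall (by linarith [hs.2])
    have h1 := ((hsub x s hs.1 (hsR.trans (hRb.trans inter_subset_right))).add_harmonic hs.1
      (h := fun w => -h w) fun w _ => (hh w).neg) (fun _ => y - h x) continuous_const fun θ => by
        by_contra! hlt
        exact Set.disjoint_left.1 hdisj (circleMap_mem_sphere x hs.1.le θ)
          ⟨hsR (circleMap_mem_closedBall x hs.1.le θ), hlt.le⟩
    have h2 : (2 * Real.pi)⁻¹ * ∫ _ in (0:ℝ)..(2 * Real.pi), (y - h x) = y - h x := by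
      have := Real.pi_pos
      rw [intervalIntegral.integral_const, smul_eq_mul]
      field_simp
      ring
    rw [h2] at h1
    have h3 : rhoHat D ρ x ≤ (y : EReal) := by
      have := add_le_add_left h1 (h x : EReal)
      rw [add_assoc, ← EReal.coe_add, ← EReal.coe_add] at this
      simpa using this
    exact hyσ.not_ge h3
  by_contra! hlt
  obtain ⟨y, hy, hyσ⟩ := EReal.lt_iff_exists_real_btwn.1 hlt
  have hy := EReal.coe_lt_coe_iff.1 hy
  refine hyσ.not_ge ?_
  rw [rhoHat_of_notMem hzD]
  refine limsup_le_of_le (by isBoundedDefault) ?_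
  filter_upwards [mem_nhdsWithin_of_mem_nhds (ball_mem_nhds z hr), self_mem_nhdsWithin,
    mem_nhdsWithin_of_mem_nhds (hhc.continuousAt.eventually_lt_const hy)] with x hxb hxD hxy
  rw [← rhoHat_of_mem (ρ := ρ) hxD]
  exact (hDle x ⟨hxb, hxD⟩).trans (EReal.coe_le_coe_iff.2 (le_of_lt hxy))

theorem subharmonicOn_rhoHat {D : Set ℂ} (hDconn : IsConnected D) {ρ : ℂ → EReal}
    (hρ : SubharmonicOn ρ D) : SubharmonicOn (rhoHat D ρ) (DHat D ρ) := by
  have husc := (upperSemicontinuous_rhoHat hρ).upperSemicontinuousOn (DHat D ρ)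
  have htop : ∀ z ∈ DHat D ρ, rhoHat D ρ z ≠ ⊤ := fun z hz => rhoHat_ne_top hρ hz
  refine ⟨isOpen_DHat hρ.1 ρ, husc, htop, fun z hz => ?_, submeanOn_of_locally husc htop
    fun z hz => ?_⟩
  · obtain ⟨w, hw⟩ := hDconn.nonempty
    obtain ⟨x, -, hx, hxb⟩ := hρ.exists_ne_bot hw univ_mem
    refine ⟨x, (isConnected_DHat hDconn ρ).isPreconnected.subset_connectedComponentIn hz
      Subset.rfl (Or.inl hx), ?_⟩
    rwa [rhoHat_of_mem hx]
  · by_cases hzD : z ∈ D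
    · obtain ⟨R, hR, hRD⟩ := Metric.nhds_basis_closedBall.mem_iff.1 (hρ.1.mem_nhds hzD)
      refine ⟨R, hR, fun r hr => ?_⟩
      have hrD := (closedBall_subset_closedBall hr.2).trans hRD
      exact (hρ.2.2.2.2.circleSubmean hr.1 hrD).congr hr.1
        fun x hx => (rhoHat_of_mem (hrD hx)).symm
    · obtain ⟨v, W, Ω, hW, hzW, hWΩ, hWG, hv, hbot⟩ := exists_nhd_subset_DHat hρ.1 ⟨hz, hzD⟩
      obtain ⟨R, hR, hRW⟩ := Metric.nhds_basis_closedBall.mem_iff.1 (hW.mem_nhds hzW)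
      refine ⟨R, hR, fun r hr => circleSubmean_of_harmonic hr.1 fun h hh hs => ?_⟩
      have hrW := (closedBall_subset_closedBall hr.2).trans hRW
      exact rhoHat_le_harmonic hρ hv hr.1 hzD (hrW.trans hWΩ) (hrW.trans hWG)
        (fun w hw => hbot w ⟨hrW hw.1, hw.2⟩) hh hs

/-- For `ρ` subharmonic on the domain `D` and bounded from below,
`D̂` is a domain with `D ⊆ D̂ ⊆ D ∪ S(D)`, `D̂ \ D` is polar, and `ρ̂` is subharmonic
on `D̂`. -/
theorem dhat_properties (D : Set ℂ) (hDopen : IsOpen D) (hDconn : IsConnected D)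
    (ρ : ℂ → EReal) (hρ : SubharmonicOn ρ D) (hbd : ∃ M : ℝ, ∀ z ∈ D, (M : EReal) ≤ ρ z) :
    IsOpen (DHat D ρ) ∧ IsConnected (DHat D ρ) ∧ D ⊆ DHat D ρ ∧
      DHat D ρ ⊆ D ∪ polarS D ∧ PolarSet (DHat D ρ \ D) ∧
      SubharmonicOn (rhoHat D ρ) (DHat D ρ) :=
  ⟨isOpen_DHat hDopen ρ, isConnected_DHat hDconn ρ, subset_union_left, DHat_subset D ρ,
    polarSet_DHat_diff hDopen ρ, subharmonicOn_rhoHat hDconn hρ⟩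
end
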